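/- arXiv:2309.04994 — 2 statements merged into one kernel-verified Lean document; each statement's English description precedes it below -/
import Mathlib

section
/- Let H be a separable reproducing kernel Hilbert space of functions on a domain Ω with kernel K, compactly embedded into L_2(Ω;ν) for a positive measure ν, satisfying the finite trace condition ∫_Ω K(x,x) ν(dx) < ∞. Then there exists a constant λ ∈ ℕ (independent of n) such that for all n, ϱ_{λn}(B_H, L_2(Ω;ν))² ≤ (1/n) Σ_{m ≥ n} d_m(B_H, L_2(Ω;ν))², where B_H is the unit ball of H. -/
open MeasureTheory RealInnerProductSpace

noncomputable def kolWidth {X : Type*} [NormedAddCommGroup X] [NormedSpace ℝ X]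
    (W : Set X) (n : ℕ) : ℝ :=
  ⨅ L : {L : Submodule ℝ X // FiniteDimensional ℝ L ∧ Module.finrank ℝ L ≤ n},
    ⨆ f : W, ⨅ g : L.1, ‖(f : X) - (g : X)‖

/-- The linear sampling `n`-width of the unit ball of `H` in the target space `Y`,
where functions in `H` are recovered from point values `ev f (x i)`. -/
noncomputable def sampWidthBall {Ω H Y : Type*} [NormedAddCommGroup H]
    [InnerProductSpace ℝ H] [NormedAddCommGroup Y] [NormedSpace ℝ Y]
    (ev : H → Ω → ℝ) (T : H →L[ℝ] Y) (n : ℕ) : ℝ :=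
  ⨅ k : Fin (n + 1), ⨅ x : Fin (k : ℕ) → Ω, ⨅ φ : Fin (k : ℕ) → Y,
    ⨆ f : Metric.closedBall (0 : H) 1, ‖T (f : H) - ∑ i, ev (f : H) (x i) • φ i‖


structure SWGood {E : Type*} [NormedAddCommGroup E] [InnerProductSpace ℝ E]
    (D R : E →L[ℝ] E) : Prop where
  sym : ∀ x y, ⟪D x, y⟫ = ⟪x, D y⟫
  pos : ∀ x, 0 ≤ ⟪D x, x⟫
  DR : ∀ x, D (R x) = x
  RD : ∀ x, R (D x) = x

section ops
variable {E : Type*} [NormedAddCommGroup E] [InnerProductSpace ℝ E]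

theorem SWGood.rsym {D R : E →L[ℝ] E} (h : SWGood D R) (x y : E) : ⟪R x, y⟫ = ⟪x, R y⟫ := by
  have := h.sym (R x) (R y)
  rw [h.DR, h.DR] at this
  exact this.symm

theorem SWGood.rpos {D R : E →L[ℝ] E} (h : SWGood D R) (x : E) : 0 ≤ ⟪x, R x⟫ := by
  have := h.pos (R x)
  rwa [h.DR] at this

theorem SWGood.cs {D R : E →L[ℝ] E} (h : SWGood D R) (x y : E) :
    ⟪x, R y⟫ ^ 2 ≤ ⟪x, R x⟫ * ⟪y, R y⟫ := by
  have key : ∀ s : ℝ, 0 ≤ ⟪y, R y⟫ * (s * s) + (2 * ⟪x, R y⟫) * s + ⟪x, R x⟫ := by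
    intro s
    have h1 := h.rpos (x + s • y)
    have h2 : ⟪y, R x⟫ = ⟪x, R y⟫ := by rw [← h.rsym, real_inner_comm]
    simp only [map_add, map_smul, inner_add_left, inner_add_right, real_inner_smul_left,
      real_inner_smul_right, h2] at h1
    linarith
  have := discrim_le_zero key
  unfold discrim at this
  nlinarith

theorem SWGood.cs' {D R : E →L[ℝ] E} (h : SWGood D R) (g f : E) :
    ⟪g, f⟫ ^ 2 ≤ ⟪g, R g⟫ * ⟪D f, f⟫ := by
  have := h.cs g (D f)
  rwa [h.RD] at this

theorem SWGood.exists_of_coercive [CompleteSpace E] (D : E →L[ℝ] E)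
    (sym : ∀ x y, ⟪D x, y⟫ = ⟪x, D y⟫) (c : ℝ) (hc : 0 < c)
    (hD : ∀ x, c * ‖x‖ ^ 2 ≤ ⟪D x, x⟫) : ∃ R, SWGood D R := by
  have hco : IsCoercive ((innerSL ℝ).comp D) := by
    refine ⟨c, hc, fun u => ?_⟩
    have := hD u
    simp only [ContinuousLinearMap.comp_apply, innerSL_apply_apply]
    nlinarith
  let e := hco.continuousLinearEquivOfBilin
  have he : ∀ x, e x = D x := by
    intro x
    refine ext_inner_right ℝ fun w => ?_
    rw [hco.continuousLinearEquivOfBilin_apply]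
    simp
  refine ⟨(e.symm : E →L[ℝ] E), sym, fun x => ?_, fun x => ?_, fun x => ?_⟩
  · exact le_trans (by positivity) (hD x)
  · rw [← he]; simp
  · rw [← he]; simp

noncomputable def swro (g : E) : E →L[ℝ] E := (innerSL ℝ g).smulRight g

theorem swro_apply (g f : E) : swro g f = ⟪g, f⟫ • g := by simp [swro]

theorem SWGood.rank {D R : E →L[ℝ] E} (h : SWGood D R) (g : E) (c : ℝ)
    (hc : 0 < 1 + c * ⟪g, R g⟫) :
    SWGood (D + c • swro g) (R - (c / (1 + c * ⟪g, R g⟫)) • swro (R g)) := by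
  have hne := hc.ne'
  have hs : ∀ f, ⟪R g, f⟫ = ⟪g, R f⟫ := fun f => h.rsym g f
  obtain ⟨q, hq⟩ : ∃ q, q = c / (1 + c * ⟪g, R g⟫) := ⟨_, rfl⟩
  have hq' : q * (1 + c * ⟪g, R g⟫) = c := by rw [hq]; field_simp
  rw [← hq]
  have e1 : ∀ x, (D + c • swro g) x = D x + (c * ⟪g, x⟫) • g := fun x => by
    simp [swro_apply, smul_smul]
  have e2 : ∀ x, (R - q • swro (R g)) x = R x - (q * ⟪g, R x⟫) • R g := fun x => by
    simp [swro_apply, smul_smul, hs]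
  refine ⟨fun x y => ?_, fun x => ?_, fun x => ?_, fun x => ?_⟩
  · rw [e1, e1, inner_add_left, inner_add_right, h.sym, real_inner_smul_left,
      real_inner_smul_right, real_inner_comm x g]
    ring
  · rw [e1, inner_add_left, real_inner_smul_left]
    have h1 := h.cs' g x
    have h2 := h.pos x
    have h3 := h.rpos g
    by_cases hc0 : 0 ≤ c
    · have : 0 ≤ c * (⟪g, x⟫ * ⟪g, x⟫) := mul_nonneg hc0 (mul_self_nonneg _)
      linarith
    · push Not at hc0
      have : c * (⟪g, R g⟫ * ⟪D x, x⟫) ≤ c * ⟪g, x⟫ ^ 2 := mul_le_mul_of_nonpos_left h1 hc0.le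
      nlinarith
  · rw [e2, e1, map_sub, map_smul, h.DR, h.DR, inner_sub_right, real_inner_smul_right]
    have : x - (q * ⟪g, R x⟫) • g + (c * (⟪g, R x⟫ - q * ⟪g, R x⟫ * ⟪g, R g⟫)) • g
      = x + (⟪g, R x⟫ * (c - q * (1 + c * ⟪g, R g⟫))) • g := by
      module
    rw [this, hq']
    simp
  · rw [e1, e2, map_add, map_smul, h.RD, inner_add_right, real_inner_smul_right]
    have : x + (c * ⟪g, x⟫) • R g - (q * (⟪g, x⟫ + c * ⟪g, x⟫ * ⟪g, R g⟫)) • R g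
      = x + (⟪g, x⟫ * (c - q * (1 + c * ⟪g, R g⟫))) • R g := by
      module
    rw [this, hq']
    simp
end ops


section steps
variable {Ω E : Type*} [MeasurableSpace Ω] {ν : Measure Ω}
  [NormedAddCommGroup E] [InnerProductSpace ℝ E]

theorem sw_int {b : Ω → E} (hbm : AEStronglyMeasurable b ν)
    (hb2 : Integrable (fun x => ‖b x‖ ^ 2) ν) (X Y : E →L[ℝ] E) :
    Integrable (fun x => ⟪X (b x), Y (b x)⟫) ν := by
  refine Integrable.mono' (hb2.const_mul (‖X‖ * ‖Y‖)) ?_ ?_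
  · exact (X.continuous.comp_aestronglyMeasurable hbm).inner
      (Y.continuous.comp_aestronglyMeasurable hbm)
  · refine Filter.Eventually.of_forall fun x => ?_
    calc ‖⟪X (b x), Y (b x)⟫‖ ≤ ‖X (b x)‖ * ‖Y (b x)‖ := norm_inner_le_norm _ _
      _ ≤ (‖X‖ * ‖b x‖) * (‖Y‖ * ‖b x‖) := by
        gcongr
        · exact X.le_opNorm _
        · exact Y.le_opNorm _
      _ = _ := by ring

theorem sw_int1 {b : Ω → E} (hbm : AEStronglyMeasurable b ν)
    (hb2 : Integrable (fun x => ‖b x‖ ^ 2) ν) (Y : E →L[ℝ] E) :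
    Integrable (fun x => ⟪b x, Y (b x)⟫) ν :=
  sw_int hbm hb2 (ContinuousLinearMap.id ℝ E) Y

theorem sw_intsq {b : Ω → E} (hbm : AEStronglyMeasurable b ν)
    (hb2 : Integrable (fun x => ‖b x‖ ^ 2) ν) (u : E) :
    Integrable (fun x => ⟪u, b x⟫ ^ 2) ν := by
  refine Integrable.mono' (hb2.const_mul (‖u‖ ^ 2)) ?_ ?_
  · exact (aestronglyMeasurable_const.inner hbm).pow 2
  · refine Filter.Eventually.of_forall fun x => ?_
    rw [norm_pow, ← mul_pow]
    gcongr
    exact norm_inner_le_norm _ _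

theorem sw_intS {Y : Type*} [NormedAddCommGroup Y] [NormedSpace ℝ Y]
    {b : Ω → E} (hbm : AEStronglyMeasurable b ν)
    (hb2 : Integrable (fun x => ‖b x‖ ^ 2) ν) (X : E →L[ℝ] Y) :
    Integrable (fun x => ‖X (b x)‖ ^ 2) ν := by
  refine Integrable.mono' (hb2.const_mul (‖X‖ ^ 2)) ?_ ?_
  · exact (X.continuous.comp_aestronglyMeasurable hbm).norm.pow 2
  · refine Filter.Eventually.of_forall fun x => ?_
    rw [norm_pow, norm_norm, ← mul_pow]
    gcongr
    exact X.le_opNorm _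

theorem sw_pot {b : Ω → E} (hbm : AEStronglyMeasurable b ν)
    (hb2 : Integrable (fun x => ‖b x‖ ^ 2) ν) (M : E →L[ℝ] E) (w : E) (κ : ℝ) :
    ∫ y, ⟪b y, (M - κ • swro w) (b y)⟫ ∂ν = ∫ y, ⟪b y, M (b y)⟫ ∂ν - κ * ∫ y, ⟪w, b y⟫ ^ 2 ∂ν := by
  rw [← integral_const_mul, ← integral_sub (sw_int1 hbm hb2 M) ((sw_intsq hbm hb2 w).const_mul κ)]
  congr 1
  ext y
  have : (M - κ • swro w) (b y) = M (b y) - (κ * ⟪w, b y⟫) • w := by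
    simp [swro_apply, smul_smul]
  rw [this, inner_sub_right, real_inner_smul_right, real_inner_comm w (b y)]
  ring

theorem sw_lower [CompleteSpace E] [Nontrivial E] {b : Ω → E} (hbm : AEStronglyMeasurable b ν)
    (hb2 : Integrable (fun x => ‖b x‖ ^ 2) ν) (hS : ∀ u, ∫ y, ⟪u, b y⟫ ^ 2 ∂ν = ‖u‖ ^ 2)
    {D R : E →L[ℝ] E} (h : SWGood D R) (hP : ∫ y, ⟪b y, R (b y)⟫ ∂ν ≤ 1 / 2) :
    ∃ L : Ω → ℝ, Integrable L ν ∧ 1 / 2 ≤ ∫ x, L x ∂ν ∧ ∀ x s, 0 < s → s ≤ L x →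
      ∃ R', SWGood (D - ContinuousLinearMap.id ℝ E + s⁻¹ • swro (b x)) R' ∧
        ∫ y, ⟪b y, R' (b y)⟫ ∂ν ≤ 1 / 2 := by
  set P := ∫ y, ⟪b y, R (b y)⟫ ∂ν with hPd
  have co : ∀ f, ‖f‖ ^ 2 ≤ P * ⟪D f, f⟫ := by
    intro f
    rw [← hS f, hPd, ← integral_mul_const]
    refine integral_mono (sw_intsq hbm hb2 f) ((sw_int1 hbm hb2 R).mul_const _) fun y => ?_
    have := h.cs' (b y) f
    rwa [real_inner_comm] at this
  obtain ⟨M, hM⟩ := SWGood.exists_of_coercive (D - ContinuousLinearMap.id ℝ E) (fun x y => by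
      simp [inner_sub_left, inner_sub_right, h.sym]) 1 one_pos (fun f => by
      have h1 := co f
      have h2 := h.pos f
      have : ⟪(D - ContinuousLinearMap.id ℝ E) f, f⟫ = ⟪D f, f⟫ - ‖f‖ ^ 2 := by
        simp [inner_sub_left]
      rw [this]
      nlinarith)
  have e1 : ∀ x, M x = R x + M (R x) := fun x => by
    have := hM.RD (R x)
    simp only [sub_apply, ContinuousLinearMap.id_apply, h.DR, map_sub] at this
    exact eq_add_of_sub_eq this
  have e2 : ∀ x, M x = R x + R (M x) := fun x => by
    have := congrArg R (hM.DR x)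
    simp only [sub_apply, ContinuousLinearMap.id_apply, h.RD, map_sub] at this
    rw [← this]; abel
  set p := ∫ y, ⟪M (b y), R (b y)⟫ ∂ν with hp
  set r := ∫ y, ⟪M (b y), R (M (b y))⟫ ∂ν with hr
  have iMR := sw_int hbm hb2 M R
  have iMRM : Integrable (fun y => ⟪M (b y), R (M (b y))⟫) ν := sw_int hbm hb2 M (R.comp M)
  have iR := sw_int1 hbm hb2 R
  have iM := sw_int1 hbm hb2 M
  have iMM := sw_intS hbm hb2 M
  have f1 : ∫ y, ⟪b y, M (b y)⟫ ∂ν = P + p := by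
    rw [hPd, hp, ← integral_add iR iMR]
    congr 1; ext y
    rw [hM.rsym, ← inner_add_right, ← e1]
  have f2 : ∫ y, ‖M (b y)‖ ^ 2 ∂ν = p + r := by
    rw [hp, hr, ← integral_add iMR iMRM]
    congr 1; ext y
    rw [← inner_add_right, ← e2, real_inner_self_eq_norm_sq]
  have r0 : 0 ≤ r := integral_nonneg fun y => h.rpos _
  have cs : p ^ 2 ≤ r * P := by
    have key : ∀ s : ℝ, 0 ≤ P * (s * s) + (2 * p) * s + r := by
      intro s
      have : P * (s * s) + (2 * p) * s + r =
          ∫ y, ⟪M (b y) + s • b y, R (M (b y) + s • b y)⟫ ∂ν := by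
        rw [hPd, hp, hr, mul_comm _ (s * s), mul_right_comm 2, ← integral_const_mul,
          ← integral_const_mul, ← integral_add (iR.const_mul _) (iMR.const_mul _),
          ← integral_add (f := fun y => s * s * ⟪b y, R (b y)⟫ + 2 * s * ⟪M (b y), R (b y)⟫)
            ((iR.const_mul _).add (iMR.const_mul _)) iMRM]
        congr 1; ext y
        have : ⟪b y, R (M (b y))⟫ = ⟪M (b y), R (b y)⟫ := by
          rw [← h.rsym, real_inner_comm]
        simp only [map_add, map_smul, inner_add_left, inner_add_right, real_inner_smul_left,
          real_inner_smul_right, this]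
        ring
      rw [this]
      exact integral_nonneg fun y => h.rpos _
    have := discrim_le_zero key
    unfold discrim at this
    nlinarith
  have hpR : ∀ y, ‖R (b y)‖ ^ 2 ≤ ⟪M (b y), R (b y)⟫ := by
    intro y
    rw [e1 (b y), inner_add_left, real_inner_self_eq_norm_sq, real_inner_comm]
    have := hM.rpos (R (b y))
    linarith
  have p0 : 0 < p := by
    have hn : 0 ≤ p := integral_nonneg fun y => le_trans (by positivity) (hpR y)
    refine lt_of_le_of_ne hn fun h0 => ?_
    have h1 : ∫ y, ‖R (b y)‖ ^ 2 ∂ν = 0 :=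
      le_antisymm (h0 ▸ integral_mono (sw_intS hbm hb2 R) iMR hpR)
        (integral_nonneg fun y => by positivity)
    rw [integral_eq_zero_iff_of_nonneg (fun y => by positivity) (sw_intS hbm hb2 R)] at h1
    obtain ⟨u, hu⟩ := exists_ne (0 : E)
    have h2 : ∫ y, ⟪u, b y⟫ ^ 2 ∂ν = 0 := by
      rw [← integral_zero Ω ℝ]
      refine integral_congr_ae ?_
      filter_upwards [h1] with y hy
      have : R (b y) = 0 := by simpa using hy
      have h3 := h.DR (b y)
      rw [this, map_zero] at h3
      simp [← h3]
    rw [hS] at h2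
    simp at h2
    exact hu h2
  refine ⟨fun x => ‖M (b x)‖ ^ 2 / p - ⟪b x, M (b x)⟫, (iMM.div_const p).sub iM, ?_, ?_⟩
  · rw [integral_sub (iMM.div_const p) iM, integral_div, f1, f2]
    have : p ≤ r / p := by
      rw [le_div_iff₀ p0]; nlinarith
    have : (p + r) / p = 1 + r / p := by field_simp
    linarith
  · intro x s hs hsL
    have a0 := hM.rpos (b x)
    refine ⟨_, hM.rank (b x) s⁻¹ (by positivity), ?_⟩
    rw [sw_pot hbm hb2, hS, f1]
    have hsa : 0 < s + ⟪b x, M (b x)⟫ := by linarith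
    have : s⁻¹ / (1 + s⁻¹ * ⟪b x, M (b x)⟫) = 1 / (s + ⟪b x, M (b x)⟫) := by
      field_simp
    rw [this]
    have h4 : p * (s + ⟪b x, M (b x)⟫) ≤ ‖M (b x)‖ ^ 2 := by
      have : s + ⟪b x, M (b x)⟫ ≤ ‖M (b x)‖ ^ 2 / p := by linarith
      rw [le_div_iff₀ p0] at this
      linarith
    have : p ≤ 1 / (s + ⟪b x, M (b x)⟫) * ‖M (b x)‖ ^ 2 := by
      rw [one_div, inv_mul_eq_div, le_div_iff₀ hsa]
      exact h4
    linarith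

theorem sw_upper [CompleteSpace E] {Y : Type*} [NormedAddCommGroup Y] [NormedSpace ℝ Y]
    {b : Ω → E} (hbm : AEStronglyMeasurable b ν)
    (hb2 : Integrable (fun x => ‖b x‖ ^ 2) ν) (S : E →L[ℝ] Y)
    (hS : ∀ u, ∫ y, ⟪u, b y⟫ ^ 2 ∂ν = ‖S u‖ ^ 2) (σ δ : ℝ) (hσ : ∀ u, ‖S u‖ ^ 2 ≤ σ * ‖u‖ ^ 2)
    (hδ : 0 < δ) (hσδ : 8 * σ ≤ δ)
    {D R : E →L[ℝ] E} (h : SWGood D R) (hP : ∫ y, ⟪b y, R (b y)⟫ ∂ν ≤ 1 / 8) :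
    ∃ U : Ω → ℝ, Integrable U ν ∧ ∫ x, U x ∂ν ≤ 1 / 4 ∧ ∀ x, 0 ≤ U x ∧ ∀ s, U x < s →
      ∃ R', SWGood (D + δ • ContinuousLinearMap.id ℝ E + (-s⁻¹) • swro (b x)) R' ∧
        ∫ y, ⟪b y, R' (b y)⟫ ∂ν ≤ 1 / 8 := by
  set P := ∫ y, ⟪b y, R (b y)⟫ ∂ν with hPd
  obtain ⟨M, hM⟩ := SWGood.exists_of_coercive (D + δ • ContinuousLinearMap.id ℝ E) (fun x y => by
      simp [inner_add_left, inner_add_right, h.sym, real_inner_smul_left,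
        real_inner_smul_right]) δ hδ (fun f => by
      have h2 := h.pos f
      have : ⟪(D + δ • ContinuousLinearMap.id ℝ E) f, f⟫ = ⟪D f, f⟫ + δ * ‖f‖ ^ 2 := by
        simp [inner_add_left, real_inner_smul_left]
      rw [this]
      linarith)
  have e1 : ∀ x, R x = M x + δ • M (R x) := fun x => by
    have := hM.RD (R x)
    simpa [h.DR] using this.symm
  have e2 : ∀ x, R x = M x + δ • R (M x) := fun x => by
    have := congrArg R (hM.DR x)
    simpa [h.RD] using this.symm
  set p := ∫ y, ‖M (b y)‖ ^ 2 ∂ν with hp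
  have iR := sw_int1 hbm hb2 R
  have iM := sw_int1 hbm hb2 M
  have iMM := sw_intS hbm hb2 M
  have iS : Integrable (fun x => ‖S (M (b x))‖ ^ 2) ν := sw_intS hbm hb2 (S.comp M)
  have f1 : ∫ y, ⟪b y, M (b y)⟫ ∂ν + δ * p ≤ P := by
    rw [hPd, hp, ← integral_const_mul, ← integral_add iM (iMM.const_mul _)]
    refine integral_mono (iM.add (iMM.const_mul _)) iR fun y => ?_
    simp only
    rw [e1, inner_add_right, real_inner_smul_right, ← hM.rsym (b y) (R (b y)), e2, inner_add_right,
      real_inner_self_eq_norm_sq, real_inner_smul_right]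
    have := h.rpos (M (b y))
    have := mul_nonneg hδ.le (mul_nonneg hδ.le this)
    linarith
  have p0 : 0 ≤ p := integral_nonneg fun y => by positivity
  have hMp : ∀ x, 0 ≤ ⟪x, M x⟫ := hM.rpos
  refine ⟨fun x => ⟪b x, M (b x)⟫ + ‖S (M (b x))‖ ^ 2 / (δ * p), iM.add (iS.div_const _),
    ?_, fun x => ⟨?_, fun s hs => ?_⟩⟩
  · rw [integral_add iM (iS.div_const _), integral_div]
    have h1 : ∫ y, ‖S (M (b y))‖ ^ 2 ∂ν ≤ σ * p := by
      rw [hp, ← integral_const_mul]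
      exact integral_mono iS (iMM.const_mul _) fun y => hσ _
    have h2 : (∫ y, ‖S (M (b y))‖ ^ 2 ∂ν) / (δ * p) ≤ 1 / 8 := by
      refine div_le_of_le_mul₀ (by positivity) (by norm_num) ?_
      nlinarith
    have : 0 ≤ δ * p := by positivity
    linarith
  · have := hMp (b x)
    positivity
  · have a0 := hMp (b x)
    simp only at hs
    have hJ0 : 0 ≤ ‖S (M (b x))‖ ^ 2 / (δ * p) := by positivity
    have hsa : 0 < s - ⟪b x, M (b x)⟫ := by linarith
    have hs0 : 0 < s := by linarith
    have hc : 0 < 1 + -s⁻¹ * ⟪b x, M (b x)⟫ := by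
      have : 1 + -s⁻¹ * ⟪b x, M (b x)⟫ = (s - ⟪b x, M (b x)⟫) / s := by field_simp; ring
      rw [this]; positivity
    refine ⟨_, hM.rank (b x) (-s⁻¹) hc, ?_⟩
    rw [sw_pot hbm hb2, hS]
    have : -s⁻¹ / (1 + -s⁻¹ * ⟪b x, M (b x)⟫) = - (1 / (s - ⟪b x, M (b x)⟫)) := by
      have h5 : 1 + -s⁻¹ * ⟪b x, M (b x)⟫ = (s - ⟪b x, M (b x)⟫) / s := by field_simp; ring
      rw [h5]
      field_simp
    rw [this]
    have hJ : ‖S (M (b x))‖ ^ 2 ≤ δ * p * (s - ⟪b x, M (b x)⟫) := by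
      rcases p0.eq_or_lt with h0 | h0
      · have : ‖S (M (b x))‖ ^ 2 ≤ ‖b x‖ ^ 2 * p := by
          rw [← hS, hp, ← integral_const_mul]
          refine integral_mono (sw_intsq hbm hb2 _) (iMM.const_mul _) fun y => ?_
          simp only
          rw [hM.rsym, ← mul_pow, ← sq_abs]
          gcongr
          exact abs_real_inner_le_norm _ _
        rw [← h0] at this ⊢
        linarith
      · have h6 : ‖S (M (b x))‖ ^ 2 / (δ * p) ≤ s - ⟪b x, M (b x)⟫ := by linarith
        rw [div_le_iff₀ (by positivity)] at h6
        linarith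
    have : 1 / (s - ⟪b x, M (b x)⟫) * ‖S (M (b x))‖ ^ 2 ≤ δ * p := by
      rw [one_div, inv_mul_eq_div, div_le_iff₀ hsa]
      exact hJ
    linarith
end steps


section iter
variable {Ω E G Y : Type*} [MeasurableSpace Ω] {ν : Measure Ω}
  [NormedAddCommGroup E] [InnerProductSpace ℝ E] [CompleteSpace E]
  [NormedAddCommGroup G] [InnerProductSpace ℝ G] [CompleteSpace G]
  [NormedAddCommGroup Y] [NormedSpace ℝ Y]

theorem SWGood.init (c : ℝ) (hc : 0 < c) :
    SWGood (c • ContinuousLinearMap.id ℝ E) (c⁻¹ • ContinuousLinearMap.id ℝ E) := by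
  refine ⟨fun x y => ?_, fun x => ?_, fun x => ?_, fun x => ?_⟩
  · simp [real_inner_smul_left, real_inner_smul_right]
  · simp only [smul_apply, ContinuousLinearMap.id_apply, real_inner_smul_left,
      real_inner_self_eq_norm_sq]
    positivity
  · simp [smul_smul, hc.ne']
  · simp [smul_smul, hc.ne']

theorem sw_iter [Nontrivial E] {b : Ω → E} (hbm : AEStronglyMeasurable b ν)
    (hb2 : Integrable (fun x => ‖b x‖ ^ 2) ν) (hS : ∀ u, ∫ y, ⟪u, b y⟫ ^ 2 ∂ν = ‖u‖ ^ 2)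
    {g : Ω → G} (hgm : AEStronglyMeasurable g ν)
    (hg2 : Integrable (fun x => ‖g x‖ ^ 2) ν) (S : G →L[ℝ] Y)
    (hSg : ∀ u, ∫ y, ⟪u, g y⟫ ^ 2 ∂ν = ‖S u‖ ^ 2) (σ δ : ℝ) (hσ : ∀ u, ‖S u‖ ^ 2 ≤ σ * ‖u‖ ^ 2)
    (hδ : 0 < δ) (hσδ : 8 * σ ≤ δ)
    (c u : ℝ) (hc : 0 < c) (hu : 0 < u) (hbc : ∫ y, ‖b y‖ ^ 2 ∂ν ≤ c / 2)
    (hgu : ∫ y, ‖g y‖ ^ 2 ∂ν ≤ u / 8) (j : ℕ) :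
    ∃ (x : Fin j → Ω) (w : Fin j → ℝ), (∀ i, 0 < w i) ∧
      (∃ D R : E →L[ℝ] E, SWGood D R ∧
        (∀ f, ⟪D f, f⟫ = ∑ i, w i * ⟪b (x i), f⟫ ^ 2 - (j - c) * ‖f‖ ^ 2) ∧
        ∫ y, ⟪b y, R (b y)⟫ ∂ν ≤ 1 / 2) ∧
      (∃ D R : G →L[ℝ] G, SWGood D R ∧
        (∀ f, ⟪D f, f⟫ = (u + j * δ) * ‖f‖ ^ 2 - ∑ i, w i * ⟪g (x i), f⟫ ^ 2) ∧
        ∫ y, ⟪g y, R (g y)⟫ ∂ν ≤ 1 / 8) := by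
  induction j with
  | zero =>
    refine ⟨Fin.elim0, Fin.elim0, fun i => i.elim0, ⟨_, _, SWGood.init c hc, fun f => ?_, ?_⟩,
      ⟨_, _, SWGood.init u hu, fun f => ?_, ?_⟩⟩
    · simp [real_inner_smul_left]
    · simp only [smul_apply, ContinuousLinearMap.id_apply, real_inner_smul_right,
        real_inner_self_eq_norm_sq, integral_const_mul]
      rw [inv_mul_le_iff₀ hc]; linarith
    · simp [real_inner_smul_left]
    · simp only [smul_apply, ContinuousLinearMap.id_apply, real_inner_smul_right,
        real_inner_self_eq_norm_sq, integral_const_mul]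
      rw [inv_mul_le_iff₀ hu]; linarith
  | succ j ih =>
    obtain ⟨x, w, hw, ⟨D, R, hDR, hD, hR⟩, ⟨D', R', hDR', hD', hR'⟩⟩ := ih
    obtain ⟨L, iL, hL, hLs⟩ := sw_lower hbm hb2 hS hDR hR
    obtain ⟨U, iU, hU, hUs⟩ := sw_upper hgm hg2 S hSg σ δ hσ hδ hσδ hDR' hR'
    obtain ⟨x0, hx0⟩ : ∃ x0, U x0 < L x0 := by
      by_contra! hcon
      have := integral_mono iL iU hcon
      linarith
    obtain ⟨hU0, hUx⟩ := hUs x0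
    have hs : 0 < L x0 := lt_of_le_of_lt hU0 hx0
    obtain ⟨R1, hR1, hp1⟩ := hLs x0 (L x0) hs le_rfl
    obtain ⟨R2, hR2, hp2⟩ := hUx (L x0) hx0
    refine ⟨Fin.snoc x x0, Fin.snoc w (L x0)⁻¹, ?_, ⟨_, R1, hR1, fun f => ?_, hp1⟩,
      ⟨_, R2, hR2, fun f => ?_, hp2⟩⟩
    · intro i
      refine Fin.lastCases ?_ (fun i => ?_) i
      · simpa using hs
      · simpa using hw i
    · rw [Fin.sum_univ_castSucc]
      simp only [Fin.snoc_castSucc, Fin.snoc_last]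
      simp only [add_apply, sub_apply, smul_apply, ContinuousLinearMap.id_apply, swro_apply,
        inner_add_left, inner_sub_left, real_inner_smul_left, hD, real_inner_self_eq_norm_sq]
      push_cast
      ring
    · rw [Fin.sum_univ_castSucc]
      simp only [Fin.snoc_castSucc, Fin.snoc_last]
      simp only [add_apply, smul_apply, ContinuousLinearMap.id_apply, swro_apply,
        inner_add_left, real_inner_smul_left, hD', real_inner_self_eq_norm_sq]
      push_cast
      ring

theorem sw_bss [Nontrivial E] {b : Ω → E} (hbm : AEStronglyMeasurable b ν)
    (hb2 : Integrable (fun x => ‖b x‖ ^ 2) ν) (hS : ∀ u, ∫ y, ⟪u, b y⟫ ^ 2 ∂ν = ‖u‖ ^ 2)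
    {g : Ω → G} (hgm : AEStronglyMeasurable g ν)
    (hg2 : Integrable (fun x => ‖g x‖ ^ 2) ν) (S : G →L[ℝ] Y)
    (hSg : ∀ u, ∫ y, ⟪u, g y⟫ ^ 2 ∂ν = ‖S u‖ ^ 2) (σ τ : ℝ) (hσ : ∀ u, ‖S u‖ ^ 2 ≤ σ * ‖u‖ ^ 2)
    (hσ0 : 0 < σ) (hτ0 : 0 < τ) (N : ℕ) (hN : 0 < N)
    (hbc : ∫ y, ‖b y‖ ^ 2 ∂ν ≤ N) (hgu : ∫ y, ‖g y‖ ^ 2 ∂ν ≤ τ) :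
    ∃ (x : Fin (3 * N) → Ω) (w : Fin (3 * N) → ℝ), (∀ i, 0 < w i) ∧
      (∀ f, ‖f‖ ^ 2 ≤ ∑ i, w i * ⟪b (x i), f⟫ ^ 2) ∧
      (∀ f, ∑ i, w i * ⟪g (x i), f⟫ ^ 2 ≤ (8 * τ / N + 24 * σ) * ‖f‖ ^ 2) := by
  have hN' : (0 : ℝ) < N := by exact_mod_cast hN
  obtain ⟨x, w, hw, ⟨D, R, hDR, hD, hR⟩, ⟨D', R', hDR', hD', hR'⟩⟩ :=
    sw_iter hbm hb2 hS hgm hg2 S hSg σ (8 * σ) hσ (by positivity) le_rfl (2 * N) (8 * τ)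
      (by positivity) (by positivity) (by linarith) (by linarith) (3 * N)
  refine ⟨x, fun i => w i / N, fun i => div_pos (hw i) hN', fun f => ?_, fun f => ?_⟩
  · have h1 := hDR.pos f
    rw [hD] at h1
    push_cast at h1
    have : ∑ i, w i / N * ⟪b (x i), f⟫ ^ 2 = (∑ i, w i * ⟪b (x i), f⟫ ^ 2) / N := by
      rw [Finset.sum_div]; congr 1; ext i; ring
    rw [this, le_div_iff₀ hN']
    linarith
  · have h1 := hDR'.pos f
    rw [hD'] at h1
    push_cast at h1
    have : ∑ i, w i / N * ⟪g (x i), f⟫ ^ 2 = (∑ i, w i * ⟪g (x i), f⟫ ^ 2) / N := by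
      rw [Finset.sum_div]; congr 1; ext i; ring
    rw [this, div_le_iff₀ hN']
    have : (8 * τ / N + 24 * σ) * ‖f‖ ^ 2 * N = (8 * τ + 3 * N * (8 * σ)) * ‖f‖ ^ 2 := by
      field_simp; ring
    linarith
end iter


section samp
variable {Ω H Y : Type*} [MeasurableSpace Ω] {ν : Measure Ω}
  [NormedAddCommGroup H] [InnerProductSpace ℝ H] [CompleteSpace H]
  [NormedAddCommGroup Y] [InnerProductSpace ℝ Y]

/-- weighted least squares -/
theorem sw_lsq {E : Type*} [NormedAddCommGroup E] [InnerProductSpace ℝ E] [CompleteSpace E]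
    {F : Type*} [NormedAddCommGroup F] [InnerProductSpace ℝ F] [CompleteSpace F]
    (Z : E →L[ℝ] F) (hZ : ∀ u, ‖u‖ ^ 2 ≤ ‖Z u‖ ^ 2) :
    ∃ A : F →L[ℝ] E, (∀ u, A (Z u) = u) ∧ ∀ y, ‖A y‖ ≤ ‖y‖ := by
  let Zs := ContinuousLinearMap.adjoint Z
  have hq : ∀ u w, ⟪Zs (Z u), w⟫ = ⟪Z u, Z w⟫ := fun u w =>
    ContinuousLinearMap.adjoint_inner_left Z w (Z u)
  obtain ⟨R, hR⟩ := SWGood.exists_of_coercive (Zs.comp Z) (fun x y => by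
    simp only [ContinuousLinearMap.comp_apply]
    rw [hq, real_inner_comm _ x, hq, real_inner_comm]) 1 one_pos (fun x => by
    simp only [ContinuousLinearMap.comp_apply]
    rw [hq, real_inner_self_eq_norm_sq, one_mul]
    exact hZ x)
  refine ⟨R.comp Zs, fun u => hR.RD u, fun y => ?_⟩
  simp only [ContinuousLinearMap.comp_apply]
  set u := R (Zs y) with hu
  have h1 : Zs (Z u) = Zs y := hR.DR (Zs y)
  have h2 : ‖Z u‖ ^ 2 = ⟪y, Z u⟫ := by
    rw [← real_inner_self_eq_norm_sq, ← hq, h1]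
    exact ContinuousLinearMap.adjoint_inner_left Z u y
  have h3 : ‖Z u‖ ≤ ‖y‖ := by
    have h4 := real_inner_le_norm y (Z u)
    rcases (norm_nonneg (Z u)).eq_or_lt with h0 | h0
    · rw [← h0]; exact norm_nonneg _
    · nlinarith
  have h5 := hZ u
  have h6 : ‖u‖ ≤ ‖Z u‖ := by
    exact (sq_le_sq₀ (norm_nonneg _) (norm_nonneg _)).1 h5
  linarith

theorem sw_samp (T : H →L[ℝ] Y) (hinj : Function.Injective T) (k : Ω → H)
    (hkm : AEStronglyMeasurable k ν) (hk2 : Integrable (fun x => ‖k x‖ ^ 2) ν)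
    (hT : ∀ f, ∫ y, ⟪f, k y⟫ ^ 2 ∂ν = ‖T f‖ ^ 2)
    (V : Submodule ℝ H) [FiniteDimensional ℝ V] (N : ℕ) (hN : 0 < N)
    (hVN : Module.finrank ℝ V ≤ N) (σ τ : ℝ) (hσ0 : 0 < σ) (hτ0 : 0 < τ)
    (hσ : ∀ f ∈ Vᗮ, ‖T f‖ ^ 2 ≤ σ * ‖f‖ ^ 2)
    (hτ : ∫ y, ‖Vᗮ.starProjection (k y)‖ ^ 2 ∂ν ≤ τ) :
    ∃ m ≤ 3 * N, ∃ (x : Fin m → Ω) (φ : Fin m → Y), ∀ f : H, ‖f‖ ≤ 1 →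
      ‖T f - ∑ i, ⟪f, k (x i)⟫ • φ i‖ ≤ √σ + √(8 * τ / N + 24 * σ) := by
  have hsq : ∀ f ∈ Vᗮ, ‖f‖ ≤ 1 → ‖T f‖ ≤ √σ := by
    intro f hf hf1
    refine Real.le_sqrt_of_sq_le ((hσ f hf).trans ?_)
    have : ‖f‖ ^ 2 ≤ 1 := pow_le_one₀ (norm_nonneg _) hf1
    nlinarith
  by_cases hV : V = ⊥
  · refine ⟨0, by omega, Fin.elim0, Fin.elim0, fun f hf => ?_⟩
    have := hsq f (by rw [hV]; simp) hf
    simp only [Finset.univ_eq_empty, Finset.sum_empty, sub_zero]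
    have := Real.sqrt_nonneg (8 * τ / N + 24 * σ)
    linarith
  let E := V.map T.toLinearMap
  let e : V ≃ₗ[ℝ] E := Submodule.equivMapOfInjective T.toLinearMap hinj V
  have hfr : Module.finrank ℝ E ≤ N := by rw [← e.finrank_eq]; exact hVN
  have : Nontrivial V := Submodule.nontrivial_iff_ne_bot.2 hV
  have : Nontrivial E := e.symm.toEquiv.nontrivial
  let v : E →L[ℝ] H := LinearMap.toContinuousLinearMap (V.subtype ∘ₗ e.symm.toLinearMap)
  have hve : ∀ p : V, v (e p) = p := fun p => by simp [v]
  have hTv : ∀ u : E, T (v u) = u := by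
    intro u
    obtain ⟨p, rfl⟩ := e.surjective u
    rw [hve]
    rfl
  let vs := ContinuousLinearMap.adjoint v
  have hvs : ∀ u x, ⟪u, vs x⟫ = ⟪v u, x⟫ := fun u x =>
    ContinuousLinearMap.adjoint_inner_right v u x
  have hbm : AEStronglyMeasurable (fun x => vs (k x)) ν :=
    vs.continuous.comp_aestronglyMeasurable hkm
  have hb2 : Integrable (fun x => ‖vs (k x)‖ ^ 2) ν := sw_intS hkm hk2 vs
  have hS : ∀ u, ∫ y, ⟪u, vs (k y)⟫ ^ 2 ∂ν = ‖u‖ ^ 2 := by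
    intro u
    simp only [hvs, hT, hTv]
    rfl
  have hbN : ∫ y, ‖vs (k y)‖ ^ 2 ∂ν ≤ N := by
    have h1 : ∀ y, ‖vs (k y)‖ ^ 2 = ∑ i, ⟪stdOrthonormalBasis ℝ E i, vs (k y)⟫ ^ 2 := fun y =>
      ((stdOrthonormalBasis ℝ E).sum_sq_inner_right (vs (k y))).symm
    simp only [h1]
    rw [integral_finsetSum _ fun i _ => sw_intsq hbm hb2 _]
    simp only [hS, OrthonormalBasis.norm_eq_one]
    simpa using hfr
  let Q := Vᗮ.starProjection
  have hQ : ∀ a c, ⟪a, Q c⟫ = ⟪Q a, c⟫ := fun a c =>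
    (Submodule.inner_starProjection_left_eq_right _ a c).symm
  obtain ⟨x, w, hw, hlow, hup⟩ := sw_bss hbm hb2 hS (g := fun x => Q (k x))
    (Q.continuous.comp_aestronglyMeasurable hkm) (sw_intS hkm hk2 Q) (T.comp Q)
    (fun u => by simp only [hQ, hT]; rfl) σ τ (fun u => by
      refine (hσ (Q u) (Submodule.starProjection_apply_mem _ _)).trans ?_
      gcongr
      exact Submodule.norm_starProjection_apply_le _ _) hσ0 hτ0 N hN hbN hτ
  let F := EuclideanSpace ℝ (Fin (3 * N))
  let W : H →L[ℝ] F := ((EuclideanSpace.equiv (Fin (3 * N)) ℝ).symm : _ →L[ℝ] F).comp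
    (ContinuousLinearMap.pi fun i => √(w i) • innerSL ℝ (k (x i)))
  have hW : ∀ f i, W f i = √(w i) * ⟪k (x i), f⟫ := fun f i => by
    simp [W]
  have hWn : ∀ f, ‖W f‖ ^ 2 = ∑ i, w i * ⟪k (x i), f⟫ ^ 2 := fun f => by
    rw [EuclideanSpace.real_norm_sq_eq]
    refine Finset.sum_congr rfl fun i _ => ?_
    rw [hW, mul_pow, Real.sq_sqrt (hw i).le]
  obtain ⟨A, hAZ, hA⟩ := sw_lsq (W.comp v) (fun u => by
    refine (hlow u).trans (le_of_eq ?_)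
    rw [ContinuousLinearMap.comp_apply, hWn]
    refine Finset.sum_congr rfl fun i _ => ?_
    rw [real_inner_comm, hvs, real_inner_comm])
  refine ⟨3 * N, le_rfl, x, fun i => √(w i) • (A (EuclideanSpace.single i 1) : Y), fun f hf => ?_⟩
  have hsum : ∑ i, ⟪f, k (x i)⟫ • √(w i) • (A (EuclideanSpace.single i 1) : Y)
      = (A (W f) : Y) := by
    have h1 : W f = ∑ i, (W f i) • (EuclideanSpace.single i (1 : ℝ) : F) := by
      ext j
      simp [Finset.sum_apply, Pi.single_apply]
    conv_rhs => rw [h1]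
    rw [map_sum, Submodule.coe_sum]
    refine Finset.sum_congr rfl fun i _ => ?_
    rw [map_smul, Submodule.coe_smul, hW, smul_smul, real_inner_comm, mul_comm]
  rw [hsum]
  let p : V := ⟨V.starProjection f, Submodule.starProjection_apply_mem _ _⟩
  have hf' : f = v (e p) + Q f := by
    rw [hve]
    exact (Submodule.starProjection_add_starProjection_orthogonal f).symm
  have hTf : T f = (e p : Y) + T (Q f) := by
    conv_lhs => rw [hf', map_add, hTv]
  have hAf : A (W f) = e p + A (W (Q f)) := by
    conv_lhs => rw [hf', map_add, map_add]
    congr 1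
    exact hAZ _
  rw [hTf, hAf, Submodule.coe_add, add_sub_add_left_eq_sub]
  have hQf : ‖Q f‖ ≤ 1 := (Submodule.norm_starProjection_apply_le _ _).trans hf
  refine (norm_sub_le _ _).trans (add_le_add (hsq _ (Submodule.starProjection_apply_mem _ _) hQf) ?_)
  refine (hA _).trans (Real.le_sqrt_of_sq_le ?_)
  have h7 := hup f
  rw [hWn]
  have h8 : ∑ i, w i * ⟪k (x i), Q f⟫ ^ 2 = ∑ i, w i * ⟪Q (k (x i)), f⟫ ^ 2 := by
    simp only [hQ]
  rw [h8]
  refine h7.trans ?_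
  have : ‖f‖ ^ 2 ≤ 1 := pow_le_one₀ (norm_nonneg _) hf
  have h9 : 0 ≤ 8 * τ / N + 24 * σ := by positivity
  nlinarith

theorem sw_width_le (T : H →L[ℝ] Y) (ev : H → Ω → ℝ) (n m : ℕ) (hm : m ≤ n)
    (x : Fin m → Ω) (φ : Fin m → Y) (c : ℝ)
    (h : ∀ f : H, ‖f‖ ≤ 1 → ‖T f - ∑ i, ev f (x i) • φ i‖ ≤ c) :
    sampWidthBall ev T n ≤ c := by
  unfold sampWidthBall
  have n1 : ∀ (k : ℕ) (x : Fin k → Ω) (φ : Fin k → Y),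
      0 ≤ ⨆ f : Metric.closedBall (0 : H) 1, ‖T (f : H) - ∑ i, ev (f : H) (x i) • φ i‖ :=
    fun k x φ => Real.iSup_nonneg fun f => norm_nonneg _
  have n2 : ∀ (k : ℕ) (x : Fin k → Ω), 0 ≤ ⨅ φ : Fin k → Y,
      ⨆ f : Metric.closedBall (0 : H) 1, ‖T (f : H) - ∑ i, ev (f : H) (x i) • φ i‖ :=
    fun k x => Real.iInf_nonneg fun φ => n1 k x φ
  have n3 : ∀ (k : ℕ), 0 ≤ ⨅ x : Fin k → Ω, ⨅ φ : Fin k → Y,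
      ⨆ f : Metric.closedBall (0 : H) 1, ‖T (f : H) - ∑ i, ev (f : H) (x i) • φ i‖ :=
    fun k => Real.iInf_nonneg fun x => n2 k x
  refine (ciInf_le ⟨0, ?_⟩ (⟨m, by omega⟩ : Fin (n + 1))).trans ?_
  · rintro _ ⟨k, rfl⟩; exact n3 k
  refine (ciInf_le ⟨0, ?_⟩ x).trans ?_
  · rintro _ ⟨k, rfl⟩; exact n2 m k
  refine (ciInf_le ⟨0, ?_⟩ φ).trans ?_
  · rintro _ ⟨k, rfl⟩; exact n1 m x k
  have : Nonempty (Metric.closedBall (0 : H) 1) := ⟨⟨0, by simp⟩⟩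
  refine ciSup_le fun f => h f ?_
  exact mem_closedBall_zero_iff.1 f.2
end samp


section kol
variable {H Y : Type*}
  [NormedAddCommGroup H] [InnerProductSpace ℝ H] [CompleteSpace H]
  [NormedAddCommGroup Y] [InnerProductSpace ℝ Y] [CompleteSpace Y]

theorem sw_inf_le {X : Type*} [NormedAddCommGroup X] [NormedSpace ℝ X] (L : Submodule ℝ X)
    (f : X) (g : X) (hg : g ∈ L) : ⨅ g : L, ‖f - (g : X)‖ ≤ ‖f - g‖ :=
  ciInf_le (f := fun g : L => ‖f - (g : X)‖)
    ⟨0, by rintro _ ⟨k, rfl⟩; exact norm_nonneg _⟩ (⟨g, hg⟩ : L)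

theorem sw_bdd (T : H →L[ℝ] Y) (L : Submodule ℝ Y) :
    BddAbove (Set.range fun f : (T '' Metric.closedBall (0 : H) 1) =>
      ⨅ g : L, ‖(f : Y) - (g : Y)‖) := by
  refine ⟨‖T‖, ?_⟩
  rintro _ ⟨⟨_, f, hf, rfl⟩, rfl⟩
  refine (sw_inf_le L (T f) 0 L.zero_mem).trans ?_
  rw [sub_zero]
  refine (T.le_opNorm f).trans ?_
  have := mem_closedBall_zero_iff.1 hf
  nlinarith [norm_nonneg T]

theorem sw_supn (T : H →L[ℝ] Y) (L : Submodule ℝ Y) :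
    0 ≤ ⨆ f : (T '' Metric.closedBall (0 : H) 1), ⨅ g : L, ‖(f : Y) - (g : Y)‖ :=
  Real.iSup_nonneg fun f => Real.iInf_nonneg fun g => norm_nonneg _

theorem sw_kol_nonneg (T : H →L[ℝ] Y) (m : ℕ) :
    0 ≤ kolWidth (T '' Metric.closedBall (0 : H) 1) m :=
  Real.iInf_nonneg fun L => sw_supn T L.1

theorem sw_kol_le' (T : H →L[ℝ] Y) (m : ℕ) (L : Submodule ℝ Y) (h1 : FiniteDimensional ℝ L)
    (h2 : Module.finrank ℝ L ≤ m) : kolWidth (T '' Metric.closedBall (0 : H) 1) m ≤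
      ⨆ f : (T '' Metric.closedBall (0 : H) 1), ⨅ g : L, ‖(f : Y) - (g : Y)‖ := by
  unfold kolWidth
  exact ciInf_le (f := fun L : {L : Submodule ℝ Y // FiniteDimensional ℝ L ∧
      Module.finrank ℝ L ≤ m} =>
      ⨆ f : (T '' Metric.closedBall (0 : H) 1), ⨅ g : L.1, ‖(f : Y) - (g : Y)‖)
    ⟨0, by rintro _ ⟨L, rfl⟩; exact sw_supn T L.1⟩ ⟨L, h1, h2⟩

theorem sw_kol_anti (T : H →L[ℝ] Y) :
    Antitone (kolWidth (T '' Metric.closedBall (0 : H) 1)) := by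
  intro m n hmn
  have : Nonempty {L : Submodule ℝ Y // FiniteDimensional ℝ L ∧ Module.finrank ℝ L ≤ m} :=
    ⟨⟨⊥, inferInstance, by simp⟩⟩
  conv_rhs => unfold kolWidth
  exact le_ciInf fun L => sw_kol_le' T n L.1 L.2.1 (L.2.2.trans hmn)

theorem sw_kol_exists (T : H →L[ℝ] Y) (m : ℕ) (ε : ℝ) (hε : 0 < ε) :
    ∃ V : Submodule ℝ H, FiniteDimensional ℝ V ∧ Module.finrank ℝ V ≤ m ∧
      ∀ f ∈ Vᗮ, ‖T f‖ ≤ (kolWidth (T '' Metric.closedBall (0 : H) 1) m + ε) * ‖f‖ := by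
  have : Nonempty {L : Submodule ℝ Y // FiniteDimensional ℝ L ∧ Module.finrank ℝ L ≤ m} :=
    ⟨⟨⊥, inferInstance, by simp⟩⟩
  obtain ⟨⟨L, hL1, hL2⟩, hL⟩ := exists_lt_of_ciInf_lt
    (show kolWidth (T '' Metric.closedBall (0 : H) 1) m <
      kolWidth (T '' Metric.closedBall (0 : H) 1) m + ε by linarith)
  simp only at hL
  set d := kolWidth (T '' Metric.closedBall (0 : H) 1) m
  let Ts := ContinuousLinearMap.adjoint T
  refine ⟨L.map Ts.toLinearMap, inferInstance, (Submodule.finrank_map_le _ _).trans hL2, ?_⟩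
  have key : ∀ f ∈ (L.map Ts.toLinearMap)ᗮ, ‖f‖ ≤ 1 → ‖T f‖ ≤ d + ε := by
    intro f hf hf1
    have hlt : ⨅ g : L, ‖T f - (g : Y)‖ < d + ε :=
      lt_of_le_of_lt (le_ciSup (sw_bdd T L) ⟨T f, f, mem_closedBall_zero_iff.2 hf1, rfl⟩) hL
    obtain ⟨g, hg⟩ := exists_lt_of_ciInf_lt hlt
    have h0 : ⟪T f, (g : Y)⟫ = 0 := by
      rw [Submodule.mem_orthogonal] at hf
      have := hf (Ts g) (Submodule.mem_map_of_mem g.2)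
      rw [ContinuousLinearMap.adjoint_inner_left] at this
      rwa [real_inner_comm]
    have h1 : ‖T f - (g : Y)‖ ^ 2 = ‖T f‖ ^ 2 + ‖(g : Y)‖ ^ 2 := by
      rw [norm_sub_sq_real, h0]; ring
    have h2 : ‖T f‖ ≤ ‖T f - (g : Y)‖ := by
      refine (sq_le_sq₀ (norm_nonneg _) (norm_nonneg _)).1 ?_
      rw [h1]; nlinarith [sq_nonneg ‖(g : Y)‖]
    linarith
  intro f hf
  by_cases h0 : f = 0
  · simp [h0]
  have hn : 0 < ‖f‖ := norm_pos_iff.2 h0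
  have := key (‖f‖⁻¹ • f) (Submodule.smul_mem _ _ hf) (by
    rw [norm_smul, norm_inv, norm_norm, inv_mul_cancel₀ hn.ne'])
  rw [map_smul, norm_smul, norm_inv, norm_norm, inv_mul_le_iff₀ hn] at this
  linarith

theorem sw_kol_le (T : H →L[ℝ] Y) (m : ℕ) (V : Submodule ℝ H) [FiniteDimensional ℝ V]
    (hV : Module.finrank ℝ V ≤ m) (c : ℝ) (hc : 0 ≤ c)
    (h : ∀ f ∈ Vᗮ, ‖T f‖ ≤ c * ‖f‖) :
    kolWidth (T '' Metric.closedBall (0 : H) 1) m ≤ c := by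
  refine (sw_kol_le' T m (V.map T.toLinearMap) inferInstance
    ((Submodule.finrank_map_le _ _).trans hV)).trans ?_
  have : Nonempty (T '' Metric.closedBall (0 : H) 1) := ⟨⟨T 0, 0, by simp, rfl⟩⟩
  refine ciSup_le ?_
  rintro ⟨_, f, hf, rfl⟩
  refine (sw_inf_le _ (T f) (T (V.starProjection f))
    (Submodule.mem_map_of_mem (Submodule.starProjection_apply_mem _ _))).trans ?_
  have h1 : T f - T (V.starProjection f) = T (Vᗮ.starProjection f) := by
    rw [← map_sub]
    congr 1
    rw [sub_eq_iff_eq_add']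
    exact (Submodule.starProjection_add_starProjection_orthogonal f).symm
  rw [h1]
  refine (h _ (Submodule.starProjection_apply_mem _ _)).trans ?_
  have h2 := (Submodule.norm_starProjection_apply_le Vᗮ f).trans (mem_closedBall_zero_iff.1 hf)
  nlinarith

variable {Ω : Type*} [MeasurableSpace Ω] {ν : Measure Ω}

theorem sw_summable (T : H →L[ℝ] Y) (k : Ω → H)
    (hkm : AEStronglyMeasurable k ν) (hk2 : Integrable (fun x => ‖k x‖ ^ 2) ν)
    (hT : ∀ f, ∫ y, ⟪f, k y⟫ ^ 2 ∂ν = ‖T f‖ ^ 2) :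
    Summable fun m => kolWidth (T '' Metric.closedBall (0 : H) 1) m ^ 2 := by
  set d := kolWidth (T '' Metric.closedBall (0 : H) 1) with hd
  have claim : ∀ M : ℕ, ∃ V : Submodule ℝ H, ∃ _ : FiniteDimensional ℝ V,
      Module.finrank ℝ V ≤ M ∧
      ∑ i ∈ Finset.range M, d i ^ 2 ≤ 4 * ∫ y, ‖V.starProjection (k y)‖ ^ 2 ∂ν := by
    intro M
    induction M with
    | zero => exact ⟨⊥, inferInstance, by simp, by simp⟩
    | succ M ih =>
      obtain ⟨V, iV, hV, hs⟩ := ih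
      obtain ⟨e, he, he1, hed⟩ : ∃ e ∈ Vᗮ, ‖e‖ ≤ 1 ∧ d M ≤ 2 * ‖T e‖ := by
        by_contra! hcon
        have h0 := hcon 0 (Submodule.zero_mem _) (by simp)
        simp only [map_zero, norm_zero, mul_zero] at h0
        have : d M ≤ d M / 2 := by
          refine sw_kol_le T M V hV _ (by linarith) fun f hf => ?_
          by_cases h0 : f = 0
          · simp [h0]
          have hn : 0 < ‖f‖ := norm_pos_iff.2 h0
          have := hcon (‖f‖⁻¹ • f) (Submodule.smul_mem _ _ hf) (by
            rw [norm_smul, norm_inv, norm_norm, inv_mul_cancel₀ hn.ne'])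
          rw [map_smul, norm_smul, norm_inv, norm_norm] at this
          have h3 : ‖f‖⁻¹ * ‖T f‖ ≤ d M / 2 := by linarith
          rw [inv_mul_le_iff₀ hn] at h3
          linarith
        linarith
      refine ⟨V ⊔ Submodule.span ℝ {e}, inferInstance, ?_, ?_⟩
      · refine (Submodule.finrank_add_le_finrank_add_finrank _ _).trans ?_
        have := finrank_span_le_card (R := ℝ) ({e} : Set H)
        simp at this
        omega
      · have hpt : ∀ y, ‖V.starProjection (k y)‖ ^ 2 + ⟪e, k y⟫ ^ 2 ≤
            ‖(V ⊔ Submodule.span ℝ {e}).starProjection (k y)‖ ^ 2 := by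
          intro y
          set z := (V ⊔ Submodule.span ℝ {e}).starProjection (k y) with hz
          have h1 : V.starProjection z = V.starProjection (k y) :=
            congrArg (fun A : H →L[ℝ] H => A (k y))
              (Submodule.starProjection_comp_starProjection_of_le
                (le_sup_left : V ≤ V ⊔ Submodule.span ℝ {e}))
          have h2 : ⟪e, z⟫ = ⟪e, k y⟫ := by
            rw [hz, ← Submodule.inner_starProjection_left_eq_right,
              Submodule.starProjection_eq_self_iff.2]
            exact (le_sup_right : _ ≤ V ⊔ Submodule.span ℝ {e})
              (Submodule.mem_span_singleton_self e)
          have h3 : ⟪e, Vᗮ.starProjection z⟫ = ⟪e, z⟫ := by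
            rw [← Submodule.inner_starProjection_left_eq_right,
              Submodule.starProjection_eq_self_iff.2 he]
          rw [Submodule.norm_sq_eq_add_norm_sq_starProjection z V, h1, ← h2, ← h3]
          refine add_le_add le_rfl ?_
          rw [← sq_abs]
          gcongr
          refine (abs_real_inner_le_norm _ _).trans ?_
          nlinarith [norm_nonneg (Vᗮ.starProjection z)]
        have hint := integral_mono ((sw_intS hkm hk2 V.starProjection).add (sw_intsq hkm hk2 e))
          (sw_intS hkm hk2 (V ⊔ Submodule.span ℝ {e}).starProjection) hpt
        have hadd : ∫ y, ((fun y => ‖V.starProjection (k y)‖ ^ 2) + fun y => ⟪e, k y⟫ ^ 2) y ∂ν =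
            ∫ y, ‖V.starProjection (k y)‖ ^ 2 ∂ν + ‖T e‖ ^ 2 := by
          rw [← hT e]
          exact integral_add (sw_intS hkm hk2 V.starProjection) (sw_intsq hkm hk2 e)
        rw [hadd] at hint
        rw [Finset.sum_range_succ]
        have h0 : 0 ≤ d M := sw_kol_nonneg T M
        nlinarith
  refine summable_of_sum_range_le (c := 4 * ∫ y, ‖k y‖ ^ 2 ∂ν) (fun n => sq_nonneg _) fun M => ?_
  obtain ⟨V, _, _, h⟩ := claim M
  refine h.trans ?_
  have := integral_mono (sw_intS hkm hk2 V.starProjection) hk2 fun y =>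
    pow_le_pow_left₀ (norm_nonneg _) (Submodule.norm_starProjection_apply_le V (k y)) 2
  linarith

theorem sw_step (T : H →L[ℝ] Y) (k : Ω → H)
    (hkm : AEStronglyMeasurable k ν) (hk2 : Integrable (fun x => ‖k x‖ ^ 2) ν)
    (hT : ∀ f, ∫ y, ⟪f, k y⟫ ^ 2 ∂ν = ‖T f‖ ^ 2) (V W : Submodule ℝ H)
    [FiniteDimensional ℝ V] [FiniteDimensional ℝ W] (hVW : V ≤ W) (β : ℝ) (hβ : 0 ≤ β)
    (hV : ∀ f ∈ Vᗮ, ‖T f‖ ≤ β * ‖f‖) :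
    ∫ y, ‖Vᗮ.starProjection (k y)‖ ^ 2 ∂ν ≤
      Module.finrank ℝ W * β ^ 2 + ∫ y, ‖Wᗮ.starProjection (k y)‖ ^ 2 ∂ν := by
  let e := stdOrthonormalBasis ℝ W
  have hpt : ∀ y, ‖Vᗮ.starProjection (k y)‖ ^ 2 =
      ∑ i, ⟪Vᗮ.starProjection (e i : H), k y⟫ ^ 2 + ‖Wᗮ.starProjection (k y)‖ ^ 2 := by
    intro y
    set z := Vᗮ.starProjection (k y) with hz
    have h1 : Wᗮ.starProjection z = Wᗮ.starProjection (k y) :=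
      congrArg (fun A : H →L[ℝ] H => A (k y))
        (Submodule.starProjection_comp_starProjection_of_le (Submodule.orthogonal_le hVW))
    rw [Submodule.norm_sq_eq_add_norm_sq_projection z W, ← e.sum_sq_inner_right]
    congr 1
    · refine Finset.sum_congr rfl fun i _ => ?_
      rw [Submodule.inner_orthogonalProjectionOnto_eq_of_mem_left, hz,
        ← Submodule.inner_starProjection_left_eq_right]
    · rw [← h1]; rfl
  simp only [hpt]
  rw [integral_add (integrable_finsetSum _ fun i _ => sw_intsq hkm hk2 _)
    (sw_intS hkm hk2 Wᗮ.starProjection), integral_finsetSum _ fun i _ => sw_intsq hkm hk2 _]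
  gcongr
  simp only [hT]
  have : ∀ i ∈ Finset.univ, ‖T (Vᗮ.starProjection (e i : H))‖ ^ 2 ≤ β ^ 2 := by
    intro i _
    refine pow_le_pow_left₀ (norm_nonneg _) ?_ 2
    refine (hV _ (Submodule.starProjection_apply_mem _ _)).trans ?_
    have h1 := Submodule.norm_starProjection_apply_le Vᗮ (e i : H)
    have h2 : ‖(e i : H)‖ = 1 := e.norm_eq_one i
    nlinarith
  refine (Finset.sum_le_sum this).trans ?_
  simp
end kol


theorem sw_block (d : ℕ → ℝ) (hd : Antitone d) (h0 : ∀ m, 0 ≤ d m) (n : ℕ)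
    (hs : Summable fun m => d m ^ 2) (K : ℕ) :
    ∑ k ∈ Finset.range K, (2 : ℝ) ^ k * n * d (2 ^ (k + 1) * n) ^ 2 ≤ ∑' m, d (n + m) ^ 2 := by
  have h1 : ∑ k ∈ Finset.range K, (2 : ℝ) ^ k * n * d (2 ^ (k + 1) * n) ^ 2 ≤
      ∑ m ∈ Finset.Ico n (2 ^ K * n), d m ^ 2 := by
    induction K with
    | zero => simp
    | succ K ih =>
      rw [Finset.sum_range_succ, ← Finset.sum_Ico_consecutive _ (m := n) (n := 2 ^ K * n)
        (k := 2 ^ (K + 1) * n)]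
      · refine add_le_add ih ?_
        have : ∀ m ∈ Finset.Ico (2 ^ K * n) (2 ^ (K + 1) * n),
            d (2 ^ (K + 1) * n) ^ 2 ≤ d m ^ 2 := by
          intro m hm
          rw [Finset.mem_Ico] at hm
          exact pow_le_pow_left₀ (h0 _) (hd hm.2.le) 2
        have h2 := Finset.card_nsmul_le_sum _ _ _ this
        refine le_trans (le_of_eq ?_) h2
        rw [Nat.card_Ico, nsmul_eq_mul]
        have : 2 ^ (K + 1) * n - 2 ^ K * n = 2 ^ K * n := by
          rw [show 2 ^ (K + 1) * n = 2 ^ K * n + 2 ^ K * n by ring]; exact Nat.add_sub_cancel _ _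
        rw [this]; push_cast; ring
      · exact Nat.le_mul_of_pos_left _ (by positivity)
      · exact Nat.mul_le_mul_right _ (Nat.pow_le_pow_right (by norm_num) (by omega))
  refine h1.trans ?_
  rw [Finset.sum_Ico_eq_sum_range]
  refine Summable.sum_le_tsum (f := fun m => d (n + m) ^ 2) _ (fun _ _ => sq_nonneg _) ?_
  exact hs.comp_injective (add_right_injective n)

section tail
variable {H : Type*} [NormedAddCommGroup H] [InnerProductSpace ℝ H] [CompleteSpace H]

theorem sw_tends [TopologicalSpace.SeparableSpace H] (W : ℕ → Submodule ℝ H)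
    [∀ k, FiniteDimensional ℝ (W k)]
    (hm : Monotone W) (hW : ∀ k, (haveI : Nonempty H := ⟨0⟩; TopologicalSpace.denseSeq H k) ∈ W k)
    (x : H) : Filter.Tendsto (fun k => (W k).starProjection x) Filter.atTop (nhds x) := by
  refine Submodule.starProjection_tendsto_self W hm x ?_
  haveI : Nonempty H := ⟨0⟩
  intro y _
  have h := TopologicalSpace.denseRange_denseSeq H y
  refine closure_mono ?_ h
  rintro _ ⟨k, rfl⟩
  exact (le_iSup W k) (hW k)

variable {Ω : Type*} [MeasurableSpace Ω] {ν : Measure Ω}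

theorem sw_tends_int [TopologicalSpace.SeparableSpace H] (W : ℕ → Submodule ℝ H)
    [∀ k, FiniteDimensional ℝ (W k)]
    (hm : Monotone W) (hW : ∀ k, (haveI : Nonempty H := ⟨0⟩; TopologicalSpace.denseSeq H k) ∈ W k)
    (k : Ω → H)
    (hkm : AEStronglyMeasurable k ν) (hk2 : Integrable (fun x => ‖k x‖ ^ 2) ν) :
    Filter.Tendsto (fun j => ∫ y, ‖(W j)ᗮ.starProjection (k y)‖ ^ 2 ∂ν) Filter.atTop (nhds 0) := by
  have h0 : (0 : ℝ) = ∫ _, (0 : ℝ) ∂ν := by simp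
  rw [h0]
  refine tendsto_integral_of_dominated_convergence (fun x => ‖k x‖ ^ 2) ?_ hk2 ?_ ?_
  · intro j
    exact (sw_intS hkm hk2 (W j)ᗮ.starProjection).aestronglyMeasurable
  · intro j
    refine Filter.Eventually.of_forall fun y => ?_
    rw [Real.norm_of_nonneg (sq_nonneg _)]
    exact pow_le_pow_left₀ (norm_nonneg _) (Submodule.norm_starProjection_apply_le _ (k y)) 2
  · refine Filter.Eventually.of_forall fun y => ?_
    have h1 := sw_tends W hm hW (k y)
    have h2 : Filter.Tendsto (fun j => ‖k y - (W j).starProjection (k y)‖ ^ 2) Filter.atTop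
        (nhds (‖k y - k y‖ ^ 2)) := ((tendsto_const_nhds.sub h1).norm).pow 2
    simp only [sub_self, norm_zero, ne_eq, OfNat.ofNat_ne_zero, not_false_eq_true, zero_pow] at h2
    refine h2.congr fun j => ?_
    congr 2
    rw [sub_eq_iff_eq_add']
    exact (Submodule.starProjection_add_starProjection_orthogonal (K := W j) (k y)).symm

theorem sw_meas [TopologicalSpace.SeparableSpace H] (k : Ω → H)
    (hk : ∀ f : H, AEStronglyMeasurable (fun y => ⟪f, k y⟫) ν) : AEStronglyMeasurable k ν := by
  classical
  haveI : Nonempty H := ⟨0⟩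
  let W : ℕ → Submodule ℝ H := fun j =>
    Submodule.span ℝ ((Finset.range (j + 1)).image (TopologicalSpace.denseSeq H) : Finset H)
  haveI : ∀ j, FiniteDimensional ℝ (W j) := fun j => by
    classical
    exact FiniteDimensional.span_finset ℝ _
  have hm : Monotone W := by
    intro i j hij
    refine Submodule.span_mono ?_
    intro x hx
    simp only [Finset.coe_image, Set.mem_image, Finset.mem_coe, Finset.mem_range] at hx ⊢
    obtain ⟨a, ha, rfl⟩ := hx
    exact ⟨a, by omega, rfl⟩
  have hW : ∀ j, TopologicalSpace.denseSeq H j ∈ W j := by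
    intro j
    refine Submodule.subset_span ?_
    simp only [Finset.coe_image, Set.mem_image, Finset.mem_coe, Finset.mem_range]
    exact ⟨j, by omega, rfl⟩
  refine aestronglyMeasurable_of_tendsto_ae Filter.atTop
    (f := fun j y => (W j).starProjection (k y)) (fun j => ?_)
    (Filter.Eventually.of_forall fun y => sw_tends W hm hW (k y))
  let e := stdOrthonormalBasis ℝ (W j)
  have : (fun y => (W j).starProjection (k y)) = fun y => ∑ i, ⟪(e i : H), k y⟫ • (e i : H) := by
    funext y
    rw [e.starProjection_eq_sum_rankOne]
    simp [InnerProductSpace.rankOne_apply]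
  rw [this]
  refine Finset.aestronglyMeasurable_fun_sum _ fun i _ => ?_
  exact (hk _).smul_const _

end tail


section fin
variable {H Y : Type*}
  [NormedAddCommGroup H] [InnerProductSpace ℝ H] [CompleteSpace H]
  [NormedAddCommGroup Y] [InnerProductSpace ℝ Y] [CompleteSpace Y]
variable {Ω : Type*} [MeasurableSpace Ω] {ν : Measure Ω}

theorem sw_tail [TopologicalSpace.SeparableSpace H] (T : H →L[ℝ] Y) (k : Ω → H)
    (hkm : AEStronglyMeasurable k ν) (hk2 : Integrable (fun x => ‖k x‖ ^ 2) ν)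
    (hT : ∀ f, ∫ y, ⟪f, k y⟫ ^ 2 ∂ν = ‖T f‖ ^ 2) (n : ℕ) (hn : 0 < n) (ε : ℝ) (hε : 0 < ε) (S : ℝ)
    (hS : S = ∑' m, kolWidth (T '' Metric.closedBall (0 : H) 1) (n + m) ^ 2) :
    ∃ V : Submodule ℝ H, ∃ _ : FiniteDimensional ℝ V, Module.finrank ℝ V ≤ 3 * n ∧
      (∀ f ∈ Vᗮ, ‖T f‖ ^ 2 ≤ ((2 * S + ε) / n) * ‖f‖ ^ 2) ∧
      ∫ y, ‖Vᗮ.starProjection (k y)‖ ^ 2 ∂ν ≤ 32 * S + ε := by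
  have : Nonempty H := ⟨0⟩
  set d := kolWidth (T '' Metric.closedBall (0 : H) 1) with hd
  have hn' : (0 : ℝ) < n := by exact_mod_cast hn
  have hn1 : (1 : ℝ) ≤ n := by exact_mod_cast hn
  have d0 : ∀ m, 0 ≤ d m := sw_kol_nonneg T
  have hblock := sw_block d (sw_kol_anti T) d0 n (sw_summable T k hkm hk2 hT)
  rw [← hS] at hblock
  let η : ℕ → ℝ := fun j => √(ε / (2 ^ (j + 5) * n * 2 ^ (j + 1)))
  have hη : ∀ j, 0 < η j := fun j => Real.sqrt_pos.2 (by positivity)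
  have hη2 : ∀ j, η j ^ 2 = ε / (2 ^ (j + 5) * n * 2 ^ (j + 1)) := fun j =>
    Real.sq_sqrt (by positivity)
  choose V iV hVr hVT using fun j : ℕ => sw_kol_exists T (2 ^ (j + 1) * n) (η j) (hη j)
  let U : ℕ → Submodule ℝ H := fun j => V j ⊔ Submodule.span ℝ {TopologicalSpace.denseSeq H j}
  have iU : ∀ j, FiniteDimensional ℝ (U j) := fun j => by
    have := iV j
    infer_instance
  have hUr : ∀ j, Module.finrank ℝ (U j) ≤ 2 ^ (j + 1) * n + 1 := by
    intro j
    have := iV j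
    refine (Submodule.finrank_add_le_finrank_add_finrank _ _).trans ?_
    have h2 := finrank_span_le_card (R := ℝ) ({TopologicalSpace.denseSeq H j} : Set H)
    simp only [Set.toFinset_singleton, Finset.card_singleton] at h2
    exact add_le_add (hVr j) h2
  obtain ⟨W, hWm, hW0, hWs⟩ : ∃ W : ℕ → Submodule ℝ H, Monotone W ∧ W 0 = U 0 ∧
      ∀ j, W (j + 1) = W j ⊔ U (j + 1) :=
    ⟨partialSups U, (partialSups U).monotone, partialSups_zero U, fun j => partialSups_add_one U j⟩
  have hUW : ∀ j, U j ≤ W j := by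
    intro j
    cases j with
    | zero => rw [hW0]
    | succ j => rw [hWs]; exact le_sup_right
  have iW : ∀ j, FiniteDimensional ℝ (W j) := by
    intro j
    induction j with
    | zero => rw [hW0]; exact iU 0
    | succ j ih => rw [hWs]; have := iU (j + 1); infer_instance
  have hWr : ∀ j, Module.finrank ℝ (W j) + 2 * n ≤ 2 ^ (j + 2) * n + j + 1 := by
    intro j
    induction j with
    | zero => rw [hW0]; have := hUr 0; simp at this ⊢; omega
    | succ j ih =>
      rw [hWs]
      have h1 := Submodule.finrank_add_le_finrank_add_finrank (W j) (U (j + 1))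
      have h2 := hUr (j + 1)
      have h3 : 2 ^ (j + 1 + 2) * n = 2 ^ (j + 2) * n + 2 ^ (j + 1 + 1) * n := by ring
      omega
  have hWr' : ∀ j, (Module.finrank ℝ (W j) : ℝ) ≤ 2 ^ (j + 3) * n := by
    intro j
    have h1 := hWr j
    have h2 : j < 2 ^ j := Nat.lt_two_pow_self
    have h3 : 2 ^ j ≤ 2 ^ j * n := Nat.le_mul_of_pos_right _ hn
    have h4 : 2 ^ (j + 3) * n = 2 ^ (j + 2) * n + 4 * (2 ^ j * n) := by ring
    have h5 : Module.finrank ℝ (W j) ≤ 2 ^ (j + 3) * n := by omega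
    exact_mod_cast h5
  have hWd : ∀ j, TopologicalSpace.denseSeq H j ∈ W j := fun j => hUW j
    ((le_sup_right : _ ≤ V j ⊔ Submodule.span ℝ {TopologicalSpace.denseSeq H j})
      (Submodule.mem_span_singleton_self _))
  have hWT : ∀ j, ∀ f ∈ (W j)ᗮ, ‖T f‖ ≤ (d (2 ^ (j + 1) * n) + η j) * ‖f‖ := fun j f hf =>
    hVT j f (Submodule.orthogonal_le ((le_sup_left : V j ≤ _).trans (hUW j)) hf)
  have hβ0 : ∀ j, 0 ≤ d (2 ^ (j + 1) * n) + η j := fun j => add_nonneg (d0 _) (hη j).le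
  have hβ : ∀ j, (d (2 ^ (j + 1) * n) + η j) ^ 2 ≤ 2 * d (2 ^ (j + 1) * n) ^ 2 + 2 * η j ^ 2 :=
    fun j => by nlinarith [sq_nonneg (d (2 ^ (j + 1) * n) - η j)]
  refine ⟨W 0, iW 0, ?_, ?_, ?_⟩
  · have := hWr 0
    simp at this
    omega
  · intro f hf
    refine (pow_le_pow_left₀ (norm_nonneg _) (hWT 0 f hf) 2).trans ?_
    rw [mul_pow]
    refine mul_le_mul_of_nonneg_right ?_ (sq_nonneg _)
    rw [le_div_iff₀ hn']
    have h1 := hblock 1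
    simp only [Finset.range_one, Finset.sum_singleton, pow_zero, one_mul] at h1
    have h2 : η 0 ^ 2 * n = ε / 64 := by
      rw [hη2]; field_simp; norm_num
    have h3 := mul_le_mul_of_nonneg_right (hβ 0) hn'.le
    nlinarith
  · have htel : ∀ K, ∫ y, ‖(W 0)ᗮ.starProjection (k y)‖ ^ 2 ∂ν + ε / 2 ^ K ≤
        32 * ∑ j ∈ Finset.range K, (2 : ℝ) ^ j * n * d (2 ^ (j + 1) * n) ^ 2 + ε +
          ∫ y, ‖(W K)ᗮ.starProjection (k y)‖ ^ 2 ∂ν := by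
      intro K
      induction K with
      | zero => simp [add_comm]
      | succ K ih =>
        have h1 := sw_step T k hkm hk2 hT (W K) (W (K + 1)) (hWm (Nat.le_succ K)) _ (hβ0 K) (hWT K)
        rw [Finset.sum_range_succ]
        have h2 : (Module.finrank ℝ (W (K + 1)) : ℝ) * (d (2 ^ (K + 1) * n) + η K) ^ 2 ≤
            (2 ^ (K + 1 + 3) * n) * (2 * d (2 ^ (K + 1) * n) ^ 2 + 2 * η K ^ 2) :=
          mul_le_mul (hWr' _) (hβ K) (sq_nonneg _) (by positivity)
        have h3 : (2 ^ (K + 1 + 3) * n) * (2 * d (2 ^ (K + 1) * n) ^ 2 + 2 * η K ^ 2) =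
            32 * (2 ^ K * n * d (2 ^ (K + 1) * n) ^ 2) + ε / 2 ^ (K + 1) := by
          rw [hη2]
          field_simp
          ring
        have h4 : ε / 2 ^ K = ε / 2 ^ (K + 1) + ε / 2 ^ (K + 1) := by
          rw [pow_succ]; field_simp; ring
        linarith
    have hlim := sw_tends_int W hWm hWd k hkm hk2
    have hlim2 := hlim.const_add (32 * S + ε)
    rw [add_zero] at hlim2
    refine ge_of_tendsto' hlim2 fun K => ?_
    have h1 := htel K
    have h2 := hblock K
    have h3 : 0 ≤ ε / 2 ^ K := by positivity
    linarith

theorem sw_main [TopologicalSpace.SeparableSpace H] (T : H →L[ℝ] Y)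
    (hinj : Function.Injective T) (k : Ω → H)
    (hkm : AEStronglyMeasurable k ν) (hk2 : Integrable (fun x => ‖k x‖ ^ 2) ν)
    (hT : ∀ f, ∫ y, ⟪f, k y⟫ ^ 2 ∂ν = ‖T f‖ ^ 2) (n : ℕ) (hn : 0 < n) :
    sampWidthBall (fun f x => ⟪f, k x⟫) T (9 * n) ^ 2 ≤
      300 / n * ∑' m, kolWidth (T '' Metric.closedBall (0 : H) 1) (n + m) ^ 2 := by
  set S := ∑' m, kolWidth (T '' Metric.closedBall (0 : H) 1) (n + m) ^ 2 with hS
  have hn' : (0 : ℝ) < n := by exact_mod_cast hn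
  have hS0 : 0 ≤ S := tsum_nonneg fun m => sq_nonneg _
  have hw0 : 0 ≤ sampWidthBall (fun f x => ⟪f, k x⟫) T (9 * n) :=
    Real.iInf_nonneg fun _ => Real.iInf_nonneg fun _ => Real.iInf_nonneg fun _ =>
      Real.iSup_nonneg fun _ => norm_nonneg _
  have key : ∀ ε : ℝ, 0 < ε → sampWidthBall (fun f x => ⟪f, k x⟫) T (9 * n) ^ 2 ≤
      300 / n * S + 60 / n * ε := by
    intro ε hε
    obtain ⟨V, iV, hVr, hVσ, hVτ⟩ := sw_tail T k hkm hk2 hT n hn ε hε S hS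
    obtain ⟨m, hm, x, φ, h⟩ := sw_samp T hinj k hkm hk2 hT V (3 * n) (by omega) hVr
      ((2 * S + ε) / n) (32 * S + ε) (by positivity) (by positivity) hVσ hVτ
    have h1 := sw_width_le T (fun f x => ⟪f, k x⟫) (9 * n) m (by omega) x φ _ h
    refine (pow_le_pow_left₀ hw0 h1 2).trans ?_
    have e1 : 0 ≤ (2 * S + ε) / n := by positivity
    have e2 : 0 ≤ 8 * (32 * S + ε) / (3 * n : ℕ) + 24 * ((2 * S + ε) / n) := by positivity
    refine (add_sq_le).trans ?_
    rw [Real.sq_sqrt e1, Real.sq_sqrt e2]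
    push_cast
    have : 300 / n * S + 60 / n * ε - 2 * ((2 * S + ε) / n +
        (8 * (32 * S + ε) / (3 * n) + 24 * ((2 * S + ε) / n))) =
        (300 * S + 60 * ε - 2 * ((2 * S + ε) + 8 * (32 * S + ε) / 3 + 24 * (2 * S + ε))) / n := by
      field_simp
      ring
    have h2 : 0 ≤ (300 * S + 60 * ε - 2 * ((2 * S + ε) + 8 * (32 * S + ε) / 3 +
      24 * (2 * S + ε))) / n := div_nonneg (by nlinarith) hn'.le
    linarith
  refine le_of_forall_pos_le_add fun δ hδ => ?_
  have := key (δ * n / 60) (by positivity)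
  refine this.trans (le_of_eq ?_)
  field_simp

end fin

/-- for a separable RKHS `H` on `Ω` (with kernel sections `kfun` and
evaluation `ev`, so `K(x,y) = ⟪kfun x, kfun y⟫`), compactly embedded into
`L₂(Ω;ν)` via `T`, satisfying the finite trace condition `∫ K(x,x) dν < ∞`,
there is `λ ∈ ℕ` with `ϱ_{λn}(B_H, L₂)² ≤ (1/n) ∑_{m ≥ n} d_m(B_H, L₂)²`. -/
theorem sampWidth_le_sum_kolWidth_rkhs {Ω H : Type*} [MeasurableSpace Ω]
    (ν : Measure Ω) [NormedAddCommGroup H] [InnerProductSpace ℝ H] [CompleteSpace H]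
    [TopologicalSpace.SeparableSpace H]
    (ev : H →ₗ[ℝ] (Ω → ℝ)) (kfun : Ω → H)
    (hrep : ∀ (f : H) (x : Ω), ev f x = ⟪f, kfun x⟫)
    (T : H →L[ℝ] Lp ℝ 2 ν) (hTcompact : IsCompactOperator T)
    (hTinj : Function.Injective T)
    (hTev : ∀ f : H, (T f : Ω → ℝ) =ᵐ[ν] ev f)
    (htrace : Integrable (fun x => ⟪kfun x, kfun x⟫) ν) :
    ∃ lam : ℕ, 0 < lam ∧ ∀ n : ℕ, 0 < n →
      (sampWidthBall (fun f => ev f) T (lam * n)) ^ 2 ≤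
        (1 / (n : ℝ)) *
          ∑' m : ℕ, (kolWidth (T '' Metric.closedBall (0 : H) 1) (n + m)) ^ 2 := by
  have hk2 : Integrable (fun x => ‖kfun x‖ ^ 2) ν := by
    simpa only [real_inner_self_eq_norm_sq] using htrace
  have hev : ∀ f : H, (T f : Ω → ℝ) =ᵐ[ν] fun x => ⟪f, kfun x⟫ := fun f => by
    filter_upwards [hTev f] with x hx
    rw [hx, hrep]
  have hkm : AEStronglyMeasurable kfun ν := sw_meas kfun fun f =>
    (Lp.aestronglyMeasurable (T f)).congr (hev f)
  have hT : ∀ f, ∫ y, ⟪f, kfun y⟫ ^ 2 ∂ν = ‖T f‖ ^ 2 := by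
    intro f
    rw [← real_inner_self_eq_norm_sq, L2.inner_def]
    refine integral_congr_ae ?_
    filter_upwards [hev f] with y hy
    rw [hy, real_inner_self_eq_norm_sq, Real.norm_eq_abs, sq_abs]
  have hevf : (fun f => ev f) = fun (f : H) (x : Ω) => ⟪f, kfun x⟫ := by
    funext f x
    exact hrep f x
  refine ⟨2700, by norm_num, fun n hn => ?_⟩
  have hn' : (0 : ℝ) < n := by exact_mod_cast hn
  have h1 := sw_main T hTinj kfun hkm hk2 hT (300 * n) (by omega)
  rw [hevf, show 2700 * n = 9 * (300 * n) by ring]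
  refine h1.trans ?_
  have hs := sw_summable T kfun hkm hk2 hT
  have h2 : (300 : ℝ) / ((300 * n : ℕ) : ℝ) = 1 / n := by
    push_cast
    field_simp
  rw [h2]
  refine mul_le_mul_of_nonneg_left ?_ (by positivity)
  refine Summable.tsum_le_tsum (fun m => ?_) (hs.comp_injective (add_right_injective (300 * n)))
    (hs.comp_injective (add_right_injective n))
  exact pow_le_pow_left₀ (sw_kol_nonneg T _) (sw_kol_anti T (by omega)) 2
end

section
/- Let H be a separable reproducing kernel Hilbert space on Ω compactly embedded into L_2(Ω;ν) with finite trace ∫_Ω K(x,x) ν(dx) < ∞. If d_n(B_H, L_2(Ω;ν)) ≤ C n^{-α} (log n)^{-β} for some α ≥ 1/2 and β ∈ ℝ, then ϱ_n(B_H, L_2(Ω;ν)) ≤ C' n^{-α} (log n)^{-β} when α > 1/2, and ϱ_n(B_H, L_2(Ω;ν)) ≤ C' n^{-α} (log n)^{-β+1/2} when α = 1/2 and β > 1/2. -/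
open MeasureTheory RealInnerProductSpace

structure GoodOp {H : Type*} [NormedAddCommGroup H] [InnerProductSpace ℝ H]
    (B M : H →L[ℝ] H) : Prop where
  symm : ∀ f g : H, ⟪B f, g⟫ = ⟪f, B g⟫
  coer : ∃ c : ℝ, 0 < c ∧ ∀ f : H, c * ‖f‖ ^ 2 ≤ ⟪B f, f⟫
  right : ∀ f, B (M f) = f
  left : ∀ f, M (B f) = f

section ops
variable {H : Type*} [NormedAddCommGroup H] [InnerProductSpace ℝ H]

lemma GoodOp.exists_of_coer [CompleteSpace H] (B : H →L[ℝ] H)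
    (symm : ∀ f g : H, ⟪B f, g⟫ = ⟪f, B g⟫)
    (coer : ∃ c : ℝ, 0 < c ∧ ∀ f : H, c * ‖f‖ ^ 2 ≤ ⟪B f, f⟫) :
    ∃ M, GoodOp B M := by
  obtain ⟨c, hc, h⟩ := coer
  have hu : IsUnit B := by
    refine ContinuousLinearMap.isUnit_of_forall_le_norm_inner_map B (c := ⟨c, hc.le⟩) hc ?_
    intro x
    have := h x
    have h2 := le_abs_self ⟪B x, x⟫
    rw [Real.norm_eq_abs]
    change ‖x‖ ^ 2 * c ≤ _
    linarith
  obtain ⟨u, rfl⟩ := hu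
  refine ⟨((u⁻¹ : (H →L[ℝ] H)ˣ) : H →L[ℝ] H), symm, ⟨c, hc, h⟩, fun f => ?_, fun f => ?_⟩
  · have := u.mul_inv
    exact congrArg (fun L : H →L[ℝ] H => L f) this
  · have := u.inv_mul
    exact congrArg (fun L : H →L[ℝ] H => L f) this

variable {B M : H →L[ℝ] H}

lemma GoodOp.nonneg (h : GoodOp B M) (f : H) : 0 ≤ ⟪B f, f⟫ := by
  obtain ⟨c, hc, h⟩ := h.coer
  exact le_trans (by positivity) (h f)

lemma GoodOp.symmM (h : GoodOp B M) (f g : H) : ⟪M f, g⟫ = ⟪f, M g⟫ := by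
  have := h.symm (M f) (M g)
  rw [h.right, h.right] at this
  exact this.symm

lemma GoodOp.nonnegM (h : GoodOp B M) (f : H) : 0 ≤ ⟪f, M f⟫ := by
  have := h.nonneg (M f)
  rwa [h.right] at this

lemma GoodOp.cs (h : GoodOp B M) (f g : H) : ⟪f, g⟫ ^ 2 ≤ ⟪B f, f⟫ * ⟪g, M g⟫ := by
  have key : ∀ t : ℝ, 0 ≤ ⟪B f, f⟫ * (t * t) + (2 * ⟪f, g⟫) * t + ⟪g, M g⟫ := by
    intro t
    have h1 := h.nonneg (t • f + M g)
    have h2 : ⟪B f, M g⟫ = ⟪f, g⟫ := by rw [h.symm, h.right]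
    simp only [map_add, map_smul, inner_add_left, inner_add_right, inner_smul_left,
      inner_smul_right, h.right, h2, real_inner_comm f g] at h1
    simp only [conj_trivial] at h1
    nlinarith
  have := discrim_le_zero key
  unfold discrim at this
  nlinarith

lemma GoodOp.M_le {a : ℝ} (h : GoodOp B M) (k : H) (h0a : 0 ≤ a)
    (ha : ∀ f, ⟪f, k⟫ ^ 2 ≤ a * ⟪B f, f⟫) :
    ⟪k, M k⟫ ≤ a := by
  have h1 := ha (M k)
  have h0 := h.nonnegM k
  rw [h.right, real_inner_comm] at h1
  rcases h0.eq_or_lt with h2 | h2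
  · rw [← h2]; exact h0a
  · nlinarith

end ops

section step
variable {Ω H Y : Type*} [MeasurableSpace Ω] {ν : Measure Ω}
  [NormedAddCommGroup H] [InnerProductSpace ℝ H]
  [NormedAddCommGroup Y] [InnerProductSpace ℝ Y]
  {k : Ω → H} {T : H →L[ℝ] Y} {S : H →L[ℝ] H}

lemma integrable_quad (hk : AEStronglyMeasurable k ν) (hk2 : Integrable (fun x => ‖k x‖ ^ 2) ν)
    (M : H →L[ℝ] H) : Integrable (fun x => ⟪k x, M (k x)⟫) ν := by
  refine (hk2.const_mul ‖M‖).mono' (hk.inner (M.continuous.comp_aestronglyMeasurable hk)) ?_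
  filter_upwards with x
  calc ‖⟪k x, M (k x)⟫‖ ≤ ‖k x‖ * ‖M (k x)‖ := norm_inner_le_norm _ _
    _ ≤ ‖k x‖ * (‖M‖ * ‖k x‖) := by gcongr; exact M.le_opNorm _
    _ = ‖M‖ * ‖k x‖ ^ 2 := by ring

lemma integrable_normsq (hk : AEStronglyMeasurable k ν) (hk2 : Integrable (fun x => ‖k x‖ ^ 2) ν)
    (L : H →L[ℝ] Y) : Integrable (fun x => ‖L (k x)‖ ^ 2) ν := by
  refine (hk2.const_mul (‖L‖ ^ 2)).mono'
    ((L.continuous.comp_aestronglyMeasurable hk).norm.pow 2) ?_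
  filter_upwards with x
  rw [Real.norm_of_nonneg (by positivity), ← mul_pow]
  gcongr
  exact L.le_opNorm _

lemma integrable_innersq (hk : AEStronglyMeasurable k ν) (hk2 : Integrable (fun x => ‖k x‖ ^ 2) ν)
    (g : H) : Integrable (fun x => ⟪g, k x⟫ ^ 2) ν := by
  refine (hk2.const_mul (‖g‖ ^ 2)).mono'
    ((aestronglyMeasurable_const.inner hk).pow 2) ?_
  filter_upwards with x
  rw [Real.norm_of_nonneg (by positivity), ← mul_pow, ← sq_abs]
  gcongr
  exact abs_real_inner_le_norm _ _

lemma GoodOp.T_le {B M : H →L[ℝ] H} (h : GoodOp B M)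
    (hk : AEStronglyMeasurable k ν) (hk2 : Integrable (fun x => ‖k x‖ ^ 2) ν)
    (hT : ∀ g, ∫ x, ⟪g, k x⟫ ^ 2 ∂ν = ‖T g‖ ^ 2) {F : ℝ}
    (hF : ∫ x, ⟪k x, M (k x)⟫ ∂ν ≤ F) (f : H) : ‖T f‖ ^ 2 ≤ F * ⟪B f, f⟫ := by
  rw [← hT]
  calc ∫ x, ⟪f, k x⟫ ^ 2 ∂ν ≤ ∫ x, ⟪B f, f⟫ * ⟪k x, M (k x)⟫ ∂ν :=
        integral_mono (integrable_innersq hk hk2 f) ((integrable_quad hk hk2 M).const_mul _)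
          (fun x => h.cs f (k x))
    _ = ⟪B f, f⟫ * ∫ x, ⟪k x, M (k x)⟫ ∂ν := integral_const_mul _ _
    _ ≤ ⟪B f, f⟫ * F := by gcongr; exact h.nonneg f
    _ = _ := mul_comm _ _

lemma step_lemma [CompleteSpace H] [Nonempty Ω] {B M : H →L[ℝ] H} (h : GoodOp B M)
    (hk : AEStronglyMeasurable k ν) (hk2 : Integrable (fun x => ‖k x‖ ^ 2) ν)
    (hS : ∀ f g, ⟪S f, g⟫ = ⟪T f, T g⟫)
    (hT : ∀ g, ∫ x, ⟪g, k x⟫ ^ 2 ∂ν = ‖T g‖ ^ 2) {F : ℝ} (hF0 : 0 < F)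
    (hF : ∫ x, ⟪k x, M (k x)⟫ ∂ν ≤ F) :
    ∃ (y : Ω) (t : ℝ) (B' M' : H →L[ℝ] H), GoodOp B' M' ∧
      (∀ f, ⟪B' f, f⟫ = ⟪B f, f⟫ - 1 / (4 * F) * ‖T f‖ ^ 2 + t * ⟪k y, f⟫ ^ 2) ∧
      ∫ x, ⟪k x, M' (k x)⟫ ∂ν ≤ F := by
  set δ : ℝ := 1 / (4 * F) with hδ
  have hδF : δ * F = 1 / 4 := by rw [hδ]; field_simp
  have hδ0 : 0 < δ := by rw [hδ]; positivity
  have hTle := h.T_le hk hk2 hT hF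
  have hSsymm : ∀ f g, ⟪S f, g⟫ = ⟪f, S g⟫ := fun f g => by
    rw [hS, real_inner_comm, ← hS, real_inner_comm]
  have hB1f : ∀ f, ⟪(B - δ • S) f, f⟫ = ⟪B f, f⟫ - δ * ‖T f‖ ^ 2 := fun f => by
    simp [inner_sub_left, inner_smul_left, hS]
  have hB1ge : ∀ f, 3 / 4 * ⟪B f, f⟫ ≤ ⟪(B - δ • S) f, f⟫ := fun f => by
    rw [hB1f]
    have := mul_le_mul_of_nonneg_left (hTle f) hδ0.le
    rw [← mul_assoc, hδF] at this
    linarith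
  obtain ⟨M1, h1⟩ : ∃ M1, GoodOp (B - δ • S) M1 := by
    apply GoodOp.exists_of_coer
    · intro f g
      simp [inner_sub_left, inner_sub_right, inner_smul_left, inner_smul_right, hSsymm, h.symm]
    · obtain ⟨c, hc, hcB⟩ := h.coer
      refine ⟨3 / 4 * c, by positivity, fun f => ?_⟩
      nlinarith [hB1ge f, hcB f]
  have hM1 : ∀ g, ⟪g, M1 g⟫ ≤ 4 / 3 * ⟪g, M g⟫ := fun g => by
    refine h1.M_le g (by have := h.nonnegM g; positivity) fun f => ?_
    have a1 := h.cs f g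
    have a2 := hB1ge f
    have a3 := h.nonnegM g
    nlinarith
  have hPhi1 : ∫ x, ⟪k x, M1 (k x)⟫ ∂ν ≤ 4 / 3 * F := by
    calc _ ≤ ∫ x, 4 / 3 * ⟪k x, M (k x)⟫ ∂ν := integral_mono (integrable_quad hk hk2 _)
          ((integrable_quad hk hk2 _).const_mul _) (fun x => hM1 _)
      _ = 4 / 3 * ∫ x, ⟪k x, M (k x)⟫ ∂ν := integral_const_mul _ _
      _ ≤ _ := by gcongr
  -- resolvent comparison
  have hres : ∀ g, M1 g = M g + δ • M (S (M1 g)) := fun g => by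
    have e1 : B (M1 g) = g + δ • S (M1 g) := by
      have := h1.right g
      simp only [sub_apply, smul_apply] at this
      rw [sub_eq_iff_eq_add] at this
      exact this
    have e2 := congrArg M e1
    rw [h.left] at e2
    rw [map_add, map_smul] at e2
    exact e2
  have hcmp : ∀ g, ⟪g, M1 g⟫ ≤ ⟪g, M g⟫ + δ * ‖T (M1 g)‖ ^ 2 := fun g => by
    have e1 : ⟪g, M1 g⟫ = ⟪g, M g⟫ + δ * ⟪M g, S (M1 g)⟫ := by
      conv_lhs => rw [hres g]
      rw [inner_add_right, inner_smul_right, h.symmM g (S (M1 g))]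
    have e2 : ⟪M g, S (M1 g)⟫ = ‖T (M1 g)‖ ^ 2 - δ * ⟪S (M1 g), M (S (M1 g))⟫ := by
      have : M g = M1 g - δ • M (S (M1 g)) := by
        rw [eq_sub_iff_add_eq]; exact (hres g).symm
      rw [this, inner_sub_left, inner_smul_left, ← hSsymm, hS, real_inner_self_eq_norm_sq,
        h.symmM]
      simp
    have e3 := h.nonnegM (S (M1 g))
    rw [e1, e2]
    nlinarith [mul_nonneg hδ0.le (mul_nonneg hδ0.le e3)]
  set D : ℝ := ∫ x, ‖T (M1 (k x))‖ ^ 2 ∂ν with hD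
  have hDint : Integrable (fun x => ‖T (M1 (k x))‖ ^ 2) ν := integrable_normsq hk hk2 (T ∘L M1)
  have hPhi1' : ∫ x, ⟪k x, M1 (k x)⟫ ∂ν ≤ F + δ * D := by
    calc _ ≤ ∫ x, (⟪k x, M (k x)⟫ + δ * ‖T (M1 (k x))‖ ^ 2) ∂ν :=
          integral_mono (integrable_quad hk hk2 _)
          ((integrable_quad hk hk2 _).add (hDint.const_mul _)) (fun x => hcmp _)
      _ = ∫ x, ⟪k x, M (k x)⟫ ∂ν + δ * D := by
          rw [integral_add (integrable_quad hk hk2 _) (hDint.const_mul _), integral_const_mul]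
      _ ≤ _ := by gcongr
  have hD0 : 0 ≤ D := integral_nonneg fun x => by positivity
  rcases hD0.eq_or_lt with hD0 | hD0
  · refine ⟨Classical.arbitrary Ω, 0, _, M1, h1, fun f => by rw [hB1f]; ring, ?_⟩
    rw [← hD0] at hPhi1'; linarith
  obtain ⟨y, hy⟩ : ∃ y, 0 < ‖T (M1 (k y))‖ ^ 2 - 2 * δ * D * ⟪k y, M1 (k y)⟫ := by
    by_contra hcon
    push Not at hcon
    have a1 := integral_nonpos (μ := ν) hcon
    rw [integral_sub hDint ((integrable_quad hk hk2 _).const_mul _), integral_const_mul] at a1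
    have a2 : 2 * δ * D * ∫ x, ⟪k x, M1 (k x)⟫ ∂ν ≤ 2 * δ * D * (4 / 3 * F) := by gcongr
    have a3 : 2 * δ * D * (4 / 3 * F) = 2 / 3 * D := by linear_combination 8 / 3 * D * hδF
    linarith
  set κ := k y with hκ
  set q := ⟪κ, M1 κ⟫ with hq
  have hq0 : 0 < q := by
    rcases (h1.nonnegM κ).eq_or_lt with h0 | h0
    · exfalso
      obtain ⟨c, hc, hcB⟩ := h1.coer
      have := hcB (M1 κ)
      rw [h1.right, ← h0] at this
      have : M1 κ = 0 := by
        by_contra hne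
        have := norm_pos_iff.2 hne
        have : 0 < c * ‖M1 κ‖ ^ 2 := by positivity
        linarith
      rw [hq, this] at hy
      simp at hy
    · exact h0
  let K : H →L[ℝ] H := InnerProductSpace.rankOne ℝ κ κ
  let G : H →L[ℝ] H := InnerProductSpace.rankOne ℝ (M1 κ) (M1 κ)
  have hK : ∀ f, K f = ⟪κ, f⟫ • κ := fun f => rfl
  have hG : ∀ f, G f = ⟪M1 κ, f⟫ • M1 κ := fun f => rfl
  have hB2f : ∀ f, ⟪((B - δ • S) + (1 / q) • K) f, f⟫
      = ⟪B f, f⟫ - δ * ‖T f‖ ^ 2 + 1 / q * ⟪κ, f⟫ ^ 2 := fun f => by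
    rw [add_apply, inner_add_left, hB1f, smul_apply, hK,
      inner_smul_left, inner_smul_left]
    simp only [conj_trivial]; ring
  have hG2 : ∀ f, ⟪f, (M1 - (1 / (2 * q)) • G) f⟫
      = ⟪f, M1 f⟫ - 1 / (2 * q) * ⟪M1 κ, f⟫ ^ 2 := fun f => by
    rw [sub_apply, inner_sub_right, smul_apply, hG,
      inner_smul_right, inner_smul_right, real_inner_comm f]
    ring
  have hM1κ : ∀ f, ⟪M1 κ, f⟫ = ⟪κ, M1 f⟫ := fun f => h1.symmM _ _
  refine ⟨y, 1 / q, (B - δ • S) + (1 / q) • K, M1 - (1 / (2 * q)) • G, ⟨?_, ?_, ?_, ?_⟩, hB2f, ?_⟩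
  · intro f g
    have := h1.symm f g
    rw [add_apply, inner_add_left, this, add_apply,
      inner_add_right, smul_apply, smul_apply, hK, hK]
    simp only [inner_smul_left, inner_smul_right, conj_trivial]
    rw [real_inner_comm f κ]; ring
  · obtain ⟨c, hc, hcB⟩ := h1.coer
    refine ⟨c, hc, fun f => ?_⟩
    have := hcB f
    rw [hB1f] at this
    rw [hB2f]
    have : 0 ≤ 1 / q * ⟪κ, f⟫ ^ 2 := by positivity
    linarith
  · intro f
    have e := h1.right f
    have e2 := h1.right κ
    have : ∀ g, ((B - δ • S) + (1 / q) • K) g = (B - δ • S) g + (1 / q) • (⟪κ, g⟫ • κ) :=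
      fun g => rfl
    rw [this]
    have : (M1 - (1 / (2 * q)) • G) f = M1 f - (1 / (2 * q)) • (⟪M1 κ, f⟫ • M1 κ) := rfl
    rw [this, map_sub, map_smul, map_smul, e, e2, inner_sub_right, inner_smul_right,
      inner_smul_right, ← hq, hM1κ, smul_smul, smul_smul, sub_add, ← sub_smul]
    have : 1 / (2 * q) * ⟪κ, M1 f⟫ - 1 / q * (⟪κ, M1 f⟫ - 1 / (2 * q) * (⟪κ, M1 f⟫ * q)) = 0 := by
      field_simp; ring
    rw [this]; simp
  · intro f
    have e := h1.left f
    have : ∀ g, ((B - δ • S) + (1 / q) • K) g = (B - δ • S) g + (1 / q) • (⟪κ, g⟫ • κ) :=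
      fun g => rfl
    rw [this]
    have : ∀ g, (M1 - (1 / (2 * q)) • G) g = M1 g - (1 / (2 * q)) • (⟪M1 κ, g⟫ • M1 κ) :=
      fun g => rfl
    rw [this, map_add, map_smul, map_smul, e, hM1κ, map_add, map_smul, map_smul, e,
      inner_add_right, inner_smul_right, inner_smul_right, ← hq, smul_smul, smul_smul,
      add_sub_assoc, ← sub_smul]
    have : 1 / q * ⟪κ, f⟫ - 1 / (2 * q) * (⟪κ, f⟫ + 1 / q * (⟪κ, f⟫ * q)) = 0 := by
      field_simp; ring
    rw [this]; simp
  · have e : ∫ x, ⟪k x, (M1 - (1 / (2 * q)) • G) (k x)⟫ ∂ν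
        = ∫ x, ⟪k x, M1 (k x)⟫ ∂ν - 1 / (2 * q) * ‖T (M1 κ)‖ ^ 2 := by
      simp_rw [hG2]
      rw [integral_sub (integrable_quad hk hk2 _) ((integrable_innersq hk hk2 _).const_mul _),
        integral_const_mul, hT]
    rw [e]
    have : δ * D ≤ 1 / (2 * q) * ‖T (M1 κ)‖ ^ 2 := by
      rw [div_mul_eq_mul_div (1 : ℝ) (2 * q), one_mul, le_div_iff₀ (by positivity)]
      linarith
    linarith

lemma iterate_lemma [CompleteSpace H] [Nonempty Ω] {B M : H →L[ℝ] H} (h : GoodOp B M)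
    (hk : AEStronglyMeasurable k ν) (hk2 : Integrable (fun x => ‖k x‖ ^ 2) ν)
    (hS : ∀ f g, ⟪S f, g⟫ = ⟪T f, T g⟫)
    (hT : ∀ g, ∫ x, ⟪g, k x⟫ ^ 2 ∂ν = ‖T g‖ ^ 2) {F : ℝ} (hF0 : 0 < F)
    (hF : ∫ x, ⟪k x, M (k x)⟫ ∂ν ≤ F) (N : ℕ) :
    ∃ (y : Fin N → Ω) (B' M' : H →L[ℝ] H), GoodOp B' M' ∧
      (∀ f, (∀ i, ⟪k (y i), f⟫ = 0) → ⟪B' f, f⟫ = ⟪B f, f⟫ - N * (1 / (4 * F)) * ‖T f‖ ^ 2) ∧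
      ∫ x, ⟪k x, M' (k x)⟫ ∂ν ≤ F := by
  induction N with
  | zero => exact ⟨Fin.elim0, B, M, h, fun f _ => by simp, hF⟩
  | succ N ih =>
    obtain ⟨y, B1, M1, h1, hB1, hF1⟩ := ih
    obtain ⟨z, t, B2, M2, h2, hB2, hF2⟩ := step_lemma h1 hk hk2 hS hT hF0 hF1
    refine ⟨Fin.snoc y z, B2, M2, h2, fun f hf => ?_, hF2⟩
    have hz : ⟪k z, f⟫ = 0 := by simpa using hf (Fin.last N)
    have hy : ∀ i, ⟪k (y i), f⟫ = 0 := fun i => by simpa using hf i.castSucc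
    rw [hB2, hB1 f hy, hz]
    push_cast
    ring

end step

section stage
variable {Ω H Y : Type*} [MeasurableSpace Ω] {ν : Measure Ω}
  [NormedAddCommGroup H] [InnerProductSpace ℝ H]
  [NormedAddCommGroup Y] [InnerProductSpace ℝ Y]
  {k : Ω → H} {T : H →L[ℝ] Y} {S : H →L[ℝ] H}

lemma exists_diag_basis (hS : ∀ f g, ⟪S f, g⟫ = ⟪T f, T g⟫) (E : Submodule ℝ H)
    [FiniteDimensional ℝ E] :
    ∃ b : OrthonormalBasis (Fin (Module.finrank ℝ E)) ℝ E,
      ∀ i j, i ≠ j → ⟪T (b i : H), T (b j : H)⟫ = 0 := by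
  let A : E →ₗ[ℝ] E := (E.orthogonalProjectionOnto : H →L[ℝ] E).toLinearMap ∘ₗ S.toLinearMap ∘ₗ E.subtype
  have hA : ∀ u v : E, ⟪A u, v⟫ = ⟪T (u : H), T (v : H)⟫ := fun u v => by
    rw [← hS]
    exact Submodule.inner_orthogonalProjectionOnto_eq_of_mem_right v (S u)
  have hsymm : A.IsSymmetric := fun u v => by
    rw [hA, real_inner_comm, ← hA, real_inner_comm]
  refine ⟨hsymm.eigenvectorBasis rfl, fun i j hij => ?_⟩
  rw [← hA, hsymm.apply_eigenvectorBasis, inner_smul_left,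
    (hsymm.eigenvectorBasis rfl).orthonormal.2 hij]
  simp

lemma finite_stage [CompleteSpace H] [Nonempty Ω]
    (hk : AEStronglyMeasurable k ν) (hk2 : Integrable (fun x => ‖k x‖ ^ 2) ν)
    (hS : ∀ f g, ⟪S f, g⟫ = ⟪T f, T g⟫)
    (hT : ∀ g, ∫ x, ⟪g, k x⟫ ^ 2 ∂ν = ‖T g‖ ^ 2)
    (E : Submodule ℝ H) [FiniteDimensional ℝ E] {m : ℕ} (hm : 0 < m)
    (hE : Module.finrank ℝ E ≤ m) {ε : ℝ} (hε : 0 < ε)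
    (ha : ∀ f ∈ Eᗮ, ‖T f‖ ^ 2 ≤ ε * ‖f‖ ^ 2)
    (hτ : ∫ x, ‖k x - E.starProjection (k x)‖ ^ 2 ∂ν ≤ m * ε) :
    ∃ y : Fin (48 * m) → Ω, ∀ f, (∀ i, ⟪k (y i), f⟫ = 0) → ‖T f‖ ^ 2 ≤ 3 * ε * ‖f‖ ^ 2 := by
  set P : H →L[ℝ] H := E.starProjection with hP
  have hPsymm : ∀ f g, ⟪P f, g⟫ = ⟪f, P g⟫ := fun f g =>
    E.starProjection_isSymmetric f g
  have hSsymm : ∀ f g, ⟪S f, g⟫ = ⟪f, S g⟫ := fun f g => by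
    rw [hS, real_inner_comm, ← hS, real_inner_comm]
  obtain ⟨b, hb⟩ := exists_diag_basis hS E
  set e : Fin (Module.finrank ℝ E) → H := fun i => (b i : H) with he
  set s : Fin (Module.finrank ℝ E) → ℝ := fun i => ‖T (e i)‖ ^ 2 with hs
  have hs0 : ∀ i, 0 ≤ s i := fun i => by positivity
  have hPf : ∀ f, P f = ∑ i, ⟪e i, f⟫ • e i := fun f => by
    rw [hP, Submodule.starProjection_apply, b.orthogonalProjectionOnto_apply_eq_sum]
    simp [he]
  let B : H →L[ℝ] H := ε • ContinuousLinearMap.id ℝ H + P ∘L S ∘L P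
  have hB : ∀ f, B f = ε • f + P (S (P f)) := fun f => rfl
  have hBf : ∀ f, ⟪B f, f⟫ = ε * ‖f‖ ^ 2 + ‖T (P f)‖ ^ 2 := fun f => by
    rw [hB, inner_add_left, inner_smul_left, hPsymm, hS, real_inner_self_eq_norm_sq,
      real_inner_self_eq_norm_sq]; rfl
  have hTP : ∀ f, ‖T (P f)‖ ^ 2 = ∑ i, s i * ⟪e i, f⟫ ^ 2 := fun f => by
    rw [← real_inner_self_eq_norm_sq, hPf, map_sum, sum_inner]
    refine Finset.sum_congr rfl fun i _ => ?_
    rw [inner_sum, Finset.sum_eq_single i]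
    · rw [map_smul, inner_smul_left, inner_smul_right, real_inner_self_eq_norm_sq]
      simp only [conj_trivial, hs]; ring
    · intro j _ hj
      rw [map_smul, map_smul, inner_smul_left, inner_smul_right, hb i j hj.symm]; simp
    · simp
  have hPn : ∀ f, ‖P f‖ ^ 2 = ∑ i, ⟪e i, f⟫ ^ 2 := fun f => by
    rw [← real_inner_self_eq_norm_sq, hPsymm]
    have : P (P f) = P f := by
      rw [hP]; exact Submodule.starProjection_eq_self_iff.2 (Submodule.starProjection_apply_mem _ _)
    rw [this, hPf, inner_sum]
    refine Finset.sum_congr rfl fun i _ => ?_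
    rw [inner_smul_right, real_inner_comm]; ring
  obtain ⟨M, hM⟩ : ∃ M, GoodOp B M := by
    apply GoodOp.exists_of_coer
    · intro f g
      rw [hB, hB, inner_add_left, inner_add_right, inner_smul_left, inner_smul_right, hPsymm,
        hSsymm, hPsymm]; rfl
    · exact ⟨ε, hε, fun f => by rw [hBf]; linarith [sq_nonneg ‖T (P f)‖]⟩
  have hquad : ∀ κ, ⟪κ, M κ⟫ ≤ 2 * (1 / ε * ‖κ - P κ‖ ^ 2 + ∑ i, 1 / (s i + ε) * ⟪e i, κ⟫ ^ 2) := by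
    intro κ
    have hnn : 0 ≤ ∑ i, 1 / (s i + ε) * ⟪e i, κ⟫ ^ 2 := Finset.sum_nonneg fun i _ => by
      have := hs0 i; positivity
    refine hM.M_le κ (by positivity) fun f => ?_
    have e1 : ⟪f, κ⟫ = ⟪f, κ - P κ⟫ + ⟪f, P κ⟫ := by rw [← inner_add_right]; simp
    have e2 : ⟪f, P κ⟫ = ∑ i, ⟪e i, f⟫ * ⟪e i, κ⟫ := by
      rw [hPf, inner_sum]
      refine Finset.sum_congr rfl fun i _ => ?_
      rw [inner_smul_right, real_inner_comm f (e i)]; ring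
    have i1 : ⟪f, κ - P κ⟫ ^ 2 ≤ ⟪B f, f⟫ * (1 / ε * ‖κ - P κ‖ ^ 2) := by
      have a1 : ⟪f, κ - P κ⟫ ^ 2 ≤ (‖f‖ * ‖κ - P κ‖) ^ 2 := by
        rw [← sq_abs]; gcongr; exact abs_real_inner_le_norm _ _
      have a2 : (‖f‖ * ‖κ - P κ‖) ^ 2 = (ε * ‖f‖ ^ 2) * (1 / ε * ‖κ - P κ‖ ^ 2) := by
        field_simp
      rw [a2] at a1
      refine a1.trans ?_
      gcongr
      rw [hBf]; linarith [sq_nonneg ‖T (P f)‖]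
    have i2 : ⟪f, P κ⟫ ^ 2 ≤ ⟪B f, f⟫ * ∑ i, 1 / (s i + ε) * ⟪e i, κ⟫ ^ 2 := by
      rw [e2]
      have a1 : (∑ i, ⟪e i, f⟫ * ⟪e i, κ⟫) ^ 2 ≤
          (∑ i, (s i + ε) * ⟪e i, f⟫ ^ 2) * ∑ i, 1 / (s i + ε) * ⟪e i, κ⟫ ^ 2 := by
        apply Finset.sum_sq_le_sum_mul_sum_of_sq_le_mul
        · intro i _; have := hs0 i; positivity
        · intro i _; have := hs0 i; positivity
        · intro i _
          have := hs0 i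
          have : s i + ε ≠ 0 := by positivity
          refine le_of_eq ?_
          field_simp
      refine a1.trans ?_
      gcongr
      have a2 : ∑ i, (s i + ε) * ⟪e i, f⟫ ^ 2 = ‖T (P f)‖ ^ 2 + ε * ‖P f‖ ^ 2 := by
        rw [hTP, hPn, Finset.mul_sum, ← Finset.sum_add_distrib]
        exact Finset.sum_congr rfl fun i _ => by ring
      rw [a2, hBf]
      have : ‖P f‖ ≤ ‖f‖ := Submodule.norm_starProjection_apply_le _ _
      have : ε * ‖P f‖ ^ 2 ≤ ε * ‖f‖ ^ 2 := by gcongr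
      linarith
    rw [e1]
    nlinarith [sq_nonneg (⟪f, κ - P κ⟫ - ⟪f, P κ⟫)]
  have hint1 : Integrable (fun x => ‖k x - P (k x)‖ ^ 2) ν := by
    have := integrable_normsq hk hk2 (ContinuousLinearMap.id ℝ H - P)
    exact this
  have hint2 : ∀ i, Integrable (fun x => 1 / (s i + ε) * ⟪e i, k x⟫ ^ 2) ν := fun i =>
    (integrable_innersq hk hk2 _).const_mul _
  have hm' : (0 : ℝ) < m := by exact_mod_cast hm
  have hF : ∫ x, ⟪k x, M (k x)⟫ ∂ν ≤ 4 * m := by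
    calc _ ≤ ∫ x, 2 * (1 / ε * ‖k x - P (k x)‖ ^ 2 + ∑ i, 1 / (s i + ε) * ⟪e i, k x⟫ ^ 2) ∂ν :=
          integral_mono (integrable_quad hk hk2 _)
            (((hint1.const_mul _).add (integrable_finsetSum _ fun i _ => hint2 i)).const_mul _)
            (fun x => hquad _)
      _ = 2 * (1 / ε * ∫ x, ‖k x - P (k x)‖ ^ 2 ∂ν + ∑ i, 1 / (s i + ε) * s i) := by
          rw [integral_const_mul, integral_add (hint1.const_mul _)
            (integrable_finsetSum _ fun i _ => hint2 i), integral_const_mul,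
            integral_finsetSum _ fun i _ => hint2 i]
          simp_rw [integral_const_mul, hT]; rfl
      _ ≤ 2 * (1 / ε * (m * ε) + ∑ i : Fin (Module.finrank ℝ E), 1) := by
          gcongr with i
          have := hs0 i
          rw [one_div_mul_eq_div, div_le_one (by positivity)]; linarith
      _ ≤ 2 * (m + m) := by
          gcongr
          · rw [mul_comm (m : ℝ), ← mul_assoc, one_div_mul_cancel hε.ne', one_mul]
          · simpa using hE
      _ = _ := by ring
  obtain ⟨y, B', M', h', hB', -⟩ := iterate_lemma hM hk hk2 hS hT (by positivity) hF (48 * m)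
  refine ⟨y, fun f hf => ?_⟩
  have a1 := hB' f hf
  have a2 := h'.nonneg f
  have a3 : ((48 * m : ℕ) : ℝ) * (1 / (4 * (4 * m))) = 3 := by
    push_cast; field_simp; norm_num
  rw [a1, a3, hBf] at a2
  have a4 : ‖T (P f)‖ ^ 2 ≤ 2 * ‖T f‖ ^ 2 + 2 * (ε * ‖f‖ ^ 2) := by
    have b1 : ‖T (f - P f)‖ ^ 2 ≤ ε * ‖f - P f‖ ^ 2 :=
      ha _ (Submodule.sub_starProjection_mem_orthogonal f)
    have b2 : ‖f - P f‖ ≤ ‖f‖ := by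
      have := E.norm_sq_eq_add_norm_sq_starProjection f
      have h2 : ‖f - P f‖ = ‖Eᗮ.starProjection f‖ := by
        rw [Submodule.starProjection_orthogonal_val]
      rw [h2]; exact Submodule.norm_starProjection_apply_le _ _
    have b3 : ε * ‖f - P f‖ ^ 2 ≤ ε * ‖f‖ ^ 2 := by gcongr
    have b4 : ‖T (P f)‖ ≤ ‖T f‖ + ‖T (f - P f)‖ := by
      have : T (P f) = T f - T (f - P f) := by rw [← map_sub]; simp
      rw [this]; exact norm_sub_le _ _
    have b5 : ‖T (P f)‖ ^ 2 ≤ (‖T f‖ + ‖T (f - P f)‖) ^ 2 := by gcongr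
    nlinarith [sq_nonneg (‖T f‖ - ‖T (f - P f)‖)]
  linarith

end stage

section tail
open Filter Topology
variable {Ω H Y : Type*} [MeasurableSpace Ω] {ν : Measure Ω}
  [NormedAddCommGroup H] [InnerProductSpace ℝ H]
  [NormedAddCommGroup Y] [InnerProductSpace ℝ Y]
  {k : Ω → H} {T : H →L[ℝ] Y} {S : H →L[ℝ] H}

lemma block_bound
    (hk : AEStronglyMeasurable k ν) (hk2 : Integrable (fun x => ‖k x‖ ^ 2) ν)
    (hT : ∀ g, ∫ x, ⟪g, k x⟫ ^ 2 ∂ν = ‖T g‖ ^ 2) (F : Submodule ℝ H) [FiniteDimensional ℝ F]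
    {a : ℝ} (ha : ∀ f ∈ F, ‖T f‖ ^ 2 ≤ a * ‖f‖ ^ 2) :
    ∫ x, ‖F.starProjection (k x)‖ ^ 2 ∂ν ≤ Module.finrank ℝ F * a := by
  let b := stdOrthonormalBasis ℝ F
  have hPn : ∀ f, ‖F.starProjection f‖ ^ 2 = ∑ i, ⟪(b i : H), f⟫ ^ 2 := fun f => by
    have h1 : ‖F.starProjection f‖ = ‖F.orthogonalProjectionOnto f‖ := rfl
    rw [h1, ← b.sum_sq_norm_inner_right (F.orthogonalProjectionOnto f)]
    refine Finset.sum_congr rfl fun i _ => ?_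
    rw [Real.norm_eq_abs, sq_abs]
    congr 1
    exact Submodule.inner_orthogonalProjectionOnto_eq_of_mem_left (b i) f
  simp_rw [hPn]
  rw [integral_finsetSum _ fun i _ => integrable_innersq hk hk2 _]
  simp_rw [hT]
  calc ∑ i, ‖T (b i : H)‖ ^ 2 ≤ ∑ i : Fin (Module.finrank ℝ F), a := by
        refine Finset.sum_le_sum fun i _ => ?_
        have h1 : ‖(b i : H)‖ = 1 := b.orthonormal.1 i
        simpa [h1] using ha (b i) (b i).2
    _ = _ := by simp

lemma tail_bound [CompleteSpace H]
    (hk : AEStronglyMeasurable k ν) (hk2 : Integrable (fun x => ‖k x‖ ^ 2) ν)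
    (hT : ∀ g, ∫ x, ⟪g, k x⟫ ^ 2 ∂ν = ‖T g‖ ^ 2) (hTinj : Function.Injective T)
    (E : ℕ → Submodule ℝ H) [∀ j, FiniteDimensional ℝ (E j)] (hmono : Monotone E)
    (hdim : ∀ j, Module.finrank ℝ (E j) ≤ 4 * 2 ^ j)
    {a : ℕ → ℝ} (ha0 : ∀ j, 0 ≤ a j)
    (ha : ∀ j, ∀ f ∈ (E j)ᗮ, ‖T f‖ ^ 2 ≤ a j * ‖f‖ ^ 2)
    (hsum : Summable (fun j => 2 ^ j * a j)) (J : ℕ) :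
    ∫ x, ‖k x - (E J).starProjection (k x)‖ ^ 2 ∂ν ≤ 8 * 2 ^ J * ∑' i, 2 ^ i * a (J + i) := by
  set W : ℕ → ℝ := fun j => ∫ x, ‖k x - (E j).starProjection (k x)‖ ^ 2 ∂ν with hW
  have hint : ∀ P : H →L[ℝ] H, Integrable (fun x => ‖k x - P (k x)‖ ^ 2) ν := fun P =>
    integrable_normsq hk hk2 (ContinuousLinearMap.id ℝ H - P)
  have hstep : ∀ j, W j ≤ W (j + 1) + 8 * 2 ^ j * a j := by
    intro j
    set F : Submodule ℝ H := E (j + 1) ⊓ (E j)ᗮ with hF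
    have hFle : F ≤ E (j + 1) := inf_le_left
    haveI : FiniteDimensional ℝ F := Submodule.finiteDimensional_of_le hFle
    have hFdim : (Module.finrank ℝ F : ℝ) ≤ 8 * 2 ^ j := by
      have h1 := (Submodule.finrank_mono hFle).trans (hdim (j + 1))
      have : 4 * 2 ^ (j + 1) = 8 * 2 ^ j := by ring
      rw [this] at h1
      exact_mod_cast h1
    have hbb := block_bound hk hk2 hT F (a := a j) (fun f hf => ha j f hf.2)
    have hpt : ∀ κ : H, ‖κ - (E j).starProjection κ‖ ^ 2 =
        ‖κ - (E (j + 1)).starProjection κ‖ ^ 2 + ‖F.starProjection κ‖ ^ 2 := by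
      intro κ
      set p := (E j).starProjection κ
      set q := (E (j + 1)).starProjection κ
      have hp : p ∈ E j := Submodule.starProjection_apply_mem _ _
      have hq : q ∈ E (j + 1) := Submodule.starProjection_apply_mem _ _
      have hpo : κ - p ∈ (E j)ᗮ := Submodule.sub_starProjection_mem_orthogonal _
      have hqo : κ - q ∈ (E (j + 1))ᗮ := Submodule.sub_starProjection_mem_orthogonal _
      have hqo' : κ - q ∈ (E j)ᗮ := Submodule.orthogonal_le (hmono (Nat.le_succ j)) hqo
      have hqpF : q - p ∈ F := by
        refine ⟨Submodule.sub_mem _ hq (hmono (Nat.le_succ j) hp), ?_⟩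
        have : q - p = (κ - p) - (κ - q) := by abel
        rw [this]; exact Submodule.sub_mem _ hpo hqo'
      have hproj : F.starProjection κ = q - p := by
        refine Submodule.eq_starProjection_of_mem_orthogonal hqpF ?_
        have : κ - (q - p) = (κ - q) + p := by abel
        rw [this]
        refine Submodule.add_mem _ (Submodule.orthogonal_le hFle hqo) ?_
        have : (E j) ≤ Fᗮ := by
          have h1 : F ≤ (E j)ᗮ := inf_le_right
          exact (Submodule.le_orthogonal_orthogonal _).trans (Submodule.orthogonal_le h1)
        exact this hp
      rw [hproj]
      have h1 : κ - p = (κ - q) + (q - p) := by abel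
      have h2 : ⟪κ - q, q - p⟫ = 0 :=
        Submodule.inner_left_of_mem_orthogonal (hFle hqpF) hqo
      rw [h1, norm_add_sq_real, h2]; ring
    have : W j = W (j + 1) + ∫ x, ‖F.starProjection (k x)‖ ^ 2 ∂ν := by
      simp only [hW]
      rw [← integral_add (hint _) (integrable_normsq hk hk2 _)]
      simp_rw [hpt]
    rw [this]
    have : (Module.finrank ℝ F : ℝ) * a j ≤ 8 * 2 ^ j * a j :=
      mul_le_mul_of_nonneg_right hFdim (ha0 j)
    linarith
  have hsum' : Summable (fun i => 2 ^ i * a (J + i)) := by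
    have h1 := (summable_nat_add_iff J).2 hsum
    have h2 := h1.mul_left ((2 : ℝ) ^ J)⁻¹
    refine h2.congr fun i => ?_
    rw [pow_add, add_comm i J]; field_simp
  have hsumle : ∀ K, W J ≤ W (J + K) + 8 * 2 ^ J * ∑ i ∈ Finset.range K, 2 ^ i * a (J + i) := by
    intro K
    induction K with
    | zero => simp
    | succ K ih =>
      rw [Finset.sum_range_succ]
      have := hstep (J + K)
      rw [← add_assoc]
      have e : (2 : ℝ) ^ (J + K) = 2 ^ J * 2 ^ K := pow_add _ _ _
      rw [e] at this
      nlinarith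
  have hdense : ⊤ ≤ (⨆ j, E j).topologicalClosure := by
    rw [top_le_iff, Submodule.topologicalClosure_eq_top_iff, Submodule.eq_bot_iff]
    intro f hf
    have hfj : ∀ j, f ∈ (E j)ᗮ := fun j => Submodule.orthogonal_le (le_iSup E j) hf
    have hlim : Tendsto (fun j => a j * ‖f‖ ^ 2) atTop (𝓝 (0 * ‖f‖ ^ 2)) := by
      refine Tendsto.mul_const _ ?_
      refine squeeze_zero ha0 (fun j => ?_) hsum.tendsto_atTop_zero
      have : (1 : ℝ) ≤ 2 ^ j := one_le_pow₀ (by norm_num)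
      nlinarith [ha0 j]
    have h0 : ‖T f‖ ^ 2 ≤ 0 * ‖f‖ ^ 2 := ge_of_tendsto' hlim fun j => ha j f (hfj j)
    have h1 : T f = 0 := by
      rw [zero_mul] at h0
      have := le_antisymm h0 (sq_nonneg _)
      simpa using this
    exact hTinj (by rw [h1, map_zero])
  have hWlim : Tendsto W atTop (𝓝 0) := by
    have h0 : (0 : ℝ) = ∫ x, (0 : ℝ) ∂ν := by simp
    rw [h0]
    refine tendsto_integral_of_dominated_convergence (fun x => ‖k x‖ ^ 2)
      (fun j => (hint _).aestronglyMeasurable) hk2 (fun j => ?_) ?_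
    · filter_upwards with x
      rw [Real.norm_of_nonneg (by positivity)]
      gcongr
      rw [← Submodule.starProjection_orthogonal_val]
      exact Submodule.norm_starProjection_apply_le _ _
    · filter_upwards with x
      have h1 := Submodule.starProjection_tendsto_self E hmono (k x) hdense
      have h2 := ((tendsto_const_nhds (x := k x)).sub h1).norm.pow 2
      simpa using h2
  have hWlim' : Tendsto (fun K => W (J + K)) atTop (𝓝 0) := by
    have := hWlim.comp (tendsto_add_atTop_nat J)
    refine this.congr fun K => ?_
    simp [add_comm]
  have hfin : Tendsto (fun K => W (J + K) + 8 * 2 ^ J * ∑ i ∈ Finset.range K, 2 ^ i * a (J + i)) atTop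
      (𝓝 (0 + 8 * 2 ^ J * ∑' i, 2 ^ i * a (J + i))) :=
    hWlim'.add (hsum'.hasSum.tendsto_sum_nat.const_mul _)
  rw [zero_add] at hfin
  exact ge_of_tendsto' hfin hsumle

lemma points_exist [CompleteSpace H] [Nonempty Ω]
    (hk : AEStronglyMeasurable k ν) (hk2 : Integrable (fun x => ‖k x‖ ^ 2) ν)
    (hS : ∀ f g, ⟪S f, g⟫ = ⟪T f, T g⟫)
    (hT : ∀ g, ∫ x, ⟪g, k x⟫ ^ 2 ∂ν = ‖T g‖ ^ 2) (hTinj : Function.Injective T)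
    (L : ℕ → Submodule ℝ H) [∀ j, FiniteDimensional ℝ (L j)]
    (hdimL : ∀ j, Module.finrank ℝ (L j) ≤ 2 ^ (j + 1))
    {a : ℕ → ℝ} (ha0 : ∀ j, 0 < a j)
    (haL : ∀ j, ∀ f ∈ (L j)ᗮ, ‖T f‖ ^ 2 ≤ a j * ‖f‖ ^ 2)
    (hsum : Summable (fun j => 2 ^ j * a j)) (J : ℕ) :
    ∃ y : Fin (192 * 2 ^ J) → Ω, ∀ f, (∀ i, ⟪k (y i), f⟫ = 0) →
      ‖T f‖ ^ 2 ≤ 6 * (∑' i, 2 ^ i * a (J + i)) * ‖f‖ ^ 2 := by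
  set E : ℕ → Submodule ℝ H := fun j => partialSups L j with hE
  have hmono : Monotone E := (partialSups L).monotone
  have hEs : ∀ j, E (j + 1) = E j ⊔ L (j + 1) := fun j => partialSups_add_one L j
  have hE0 : E 0 = L 0 := partialSups_zero L
  have hfd : ∀ j, FiniteDimensional ℝ (E j) ∧ Module.finrank ℝ (E j) + 2 ≤ 4 * 2 ^ j := by
    intro j
    induction j with
    | zero =>
      rw [hE0]
      exact ⟨inferInstance, by have := hdimL 0; norm_num at this ⊢; omega⟩
    | succ j ih =>
      obtain ⟨i1, i2⟩ := ih
      rw [hEs]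
      refine ⟨inferInstance, ?_⟩
      have h1 := Submodule.finrank_add_le_finrank_add_finrank (E j) (L (j + 1))
      have h2 := hdimL (j + 1)
      have e1 : 2 ^ (j + 1 + 1) = 4 * 2 ^ j := by ring
      have e2 : 2 ^ (j + 1) = 2 * 2 ^ j := by ring
      omega
  haveI : ∀ j, FiniteDimensional ℝ (E j) := fun j => (hfd j).1
  have hdim : ∀ j, Module.finrank ℝ (E j) ≤ 4 * 2 ^ j := fun j => by have := (hfd j).2; omega
  have ha : ∀ j, ∀ f ∈ (E j)ᗮ, ‖T f‖ ^ 2 ≤ a j * ‖f‖ ^ 2 := fun j f hf =>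
    haL j f (Submodule.orthogonal_le (le_partialSups L j) hf)
  have ht := tail_bound hk hk2 hT hTinj E hmono hdim (fun j => (ha0 j).le) ha hsum J
  have hsum' : Summable (fun i => 2 ^ i * a (J + i)) := by
    have h1 := (summable_nat_add_iff J).2 hsum
    have h2 := h1.mul_left ((2 : ℝ) ^ J)⁻¹
    refine h2.congr fun i => ?_
    rw [pow_add, add_comm i J]; field_simp
  set A := ∑' i, 2 ^ i * a (J + i) with hA
  have hAJ : a J ≤ A := by
    have := hsum'.le_tsum 0 (fun i _ => by have := ha0 (J + i); positivity)
    simpa using this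
  have hA0 : 0 < A := (ha0 J).trans_le hAJ
  obtain ⟨y, hy⟩ := finite_stage hk hk2 hS hT (E J) (m := 4 * 2 ^ J) (by positivity) (hdim J)
    (ε := 2 * A) (by positivity)
    (fun f hf => (ha J f hf).trans (by gcongr; linarith))
    (by push_cast; linarith)
  have e : 192 * 2 ^ J = 48 * (4 * 2 ^ J) := by ring
  rw [e]
  refine ⟨y, fun f hf => (hy f hf).trans (le_of_eq (by ring))⟩

end tail

section widths
open Filter Topology

lemma kol_subspace {H Y : Type*} [NormedAddCommGroup H] [InnerProductSpace ℝ H] [CompleteSpace H]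
    [NormedAddCommGroup Y] [InnerProductSpace ℝ Y] [CompleteSpace Y] (T : H →L[ℝ] Y) (n : ℕ) (c : ℝ)
    (hc : kolWidth (T '' Metric.closedBall (0 : H) 1) n < c) :
    ∃ L : Submodule ℝ H, FiniteDimensional ℝ L ∧ Module.finrank ℝ L ≤ n ∧
      ∀ f ∈ Lᗮ, ‖T f‖ ≤ c * ‖f‖ := by
  have : Nonempty {L : Submodule ℝ Y // FiniteDimensional ℝ L ∧ Module.finrank ℝ L ≤ n} :=
    ⟨⟨⊥, inferInstance, by simp⟩⟩
  obtain ⟨⟨L, hLf, hLn⟩, hL⟩ := exists_lt_of_ciInf_lt hc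
  refine ⟨L.map (T.adjoint : Y →L[ℝ] H).toLinearMap, inferInstance,
    (Submodule.finrank_map_le _ _).trans hLn, fun f hf => ?_⟩
  have horth : ∀ g ∈ L, ⟪g, T f⟫ = 0 := fun g hg => by
    rw [← ContinuousLinearMap.adjoint_inner_left]
    exact hf _ (Submodule.mem_map_of_mem hg)
  have hball : ∀ u : H, ‖u‖ ≤ 1 → (∀ g ∈ L, ⟪g, T u⟫ = 0) → ‖T u‖ ≤ c := by
    intro u hu hou
    have h1 : ‖T u‖ ≤ ⨅ g : L, ‖T u - (g : Y)‖ := by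
      refine le_ciInf fun g => ?_
      have h2 : ‖T u - (g : Y)‖ ^ 2 = ‖T u‖ ^ 2 + ‖(g : Y)‖ ^ 2 := by
        rw [norm_sub_sq_real, real_inner_comm, hou g g.2]; ring
      exact le_of_sq_le_sq (by nlinarith [sq_nonneg ‖(g : Y)‖]) (norm_nonneg _)
    have hbdd : BddAbove (Set.range fun w : (T '' Metric.closedBall (0 : H) 1) =>
        ⨅ g : L, ‖(w : Y) - (g : Y)‖) := by
      refine ⟨‖T‖, ?_⟩
      rintro _ ⟨⟨_, v, hv, rfl⟩, rfl⟩
      have h3 : ⨅ g : L, ‖T v - (g : Y)‖ ≤ ‖T v - ((0 : L) : Y)‖ :=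
        ciInf_le ⟨0, by rintro _ ⟨g, rfl⟩; exact norm_nonneg _⟩ _
      refine h3.trans ?_
      have : ‖v‖ ≤ 1 := by simpa using hv
      simpa using T.le_of_opNorm_le_of_le le_rfl this
    have h2 := le_ciSup hbdd ⟨T u, u, by simpa using hu, rfl⟩
    exact (h1.trans h2).trans hL.le
  by_cases hf0 : f = 0
  · simp [hf0]
  have hn : 0 < ‖f‖ := norm_pos_iff.2 hf0
  have := hball (‖f‖⁻¹ • f) (by rw [norm_smul, norm_inv, norm_norm, inv_mul_cancel₀ hn.ne'])
    (fun g hg => by rw [map_smul, inner_smul_right, horth g hg, mul_zero])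
  rw [map_smul, norm_smul, norm_inv, norm_norm, inv_mul_le_iff₀ hn] at this
  linarith

lemma factor_lemma {H Y : Type*} [AddCommGroup H] [Module ℝ H] [AddCommGroup Y] [Module ℝ Y]
    {N : ℕ} (l : H →ₗ[ℝ] (Fin N → ℝ)) (h : H →ₗ[ℝ] Y) (hker : ∀ f, l f = 0 → h f = 0) :
    ∃ φ : Fin N → Y, ∀ f, h f = ∑ i, l f i • φ i := by
  obtain ⟨s, hs⟩ := l.rangeRestrict.exists_rightInverse_of_surjective l.range_rangeRestrict
  obtain ⟨g, hg⟩ := LinearMap.exists_extend (h ∘ₗ s)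
  have key : ∀ f, h f = g (l f) := fun f => by
    have h1 : g (l f) = h (s (l.rangeRestrict f)) := by
      have := congrArg (fun q => q (l.rangeRestrict f)) hg
      simpa using this
    have h2 : l.rangeRestrict (s (l.rangeRestrict f)) = l.rangeRestrict f :=
      congrArg (fun q => q (l.rangeRestrict f)) hs
    have h3 : l (s (l.rangeRestrict f)) = l f := congrArg Subtype.val h2
    have h4 := hker (f - s (l.rangeRestrict f)) (by rw [map_sub, h3, sub_self])
    rw [h1, ← sub_eq_zero, ← map_sub, h4]
  refine ⟨fun i => g (Pi.single i 1), fun f => ?_⟩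
  rw [key]
  conv_lhs => rw [pi_eq_sum_univ' (l f)]
  rw [map_sum]
  simp only [map_smul]

variable {Ω H Y : Type*} [NormedAddCommGroup H] [InnerProductSpace ℝ H]
    [NormedAddCommGroup Y] [NormedSpace ℝ Y]

lemma samp_le (ev : H → Ω → ℝ) (T : H →L[ℝ] Y) {n N : ℕ} (hN : N ≤ n) (y : Fin N → Ω)
    (φ : Fin N → Y) {c : ℝ} (hc : 0 ≤ c)
    (h : ∀ f : H, ‖f‖ ≤ 1 → ‖T f - ∑ i, ev f (y i) • φ i‖ ≤ c) :
    sampWidthBall ev T n ≤ c := by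
  unfold sampWidthBall
  have hb : ∀ (k : ℕ) (x : Fin k → Ω) (ψ : Fin k → Y), 0 ≤
      ⨆ f : Metric.closedBall (0 : H) 1, ‖T (f : H) - ∑ i, ev (f : H) (x i) • ψ i‖ :=
    fun k x ψ => Real.iSup_nonneg fun f => norm_nonneg _
  refine (ciInf_le ⟨0, ?_⟩ (⟨N, by omega⟩ : Fin (n + 1))).trans ?_
  · rintro _ ⟨k, rfl⟩
    exact Real.iInf_nonneg fun x => Real.iInf_nonneg fun ψ => hb _ x ψ
  refine (ciInf_le ⟨0, ?_⟩ y).trans ?_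
  · rintro _ ⟨x, rfl⟩
    exact Real.iInf_nonneg fun ψ => hb _ x ψ
  refine (ciInf_le ⟨0, ?_⟩ φ).trans ?_
  · rintro _ ⟨ψ, rfl⟩
    exact hb _ y ψ
  exact Real.iSup_le (fun f => h f (mem_closedBall_zero_iff.1 f.2)) hc

lemma samp_le_norm (ev : H → Ω → ℝ) (T : H →L[ℝ] Y) (n : ℕ) : sampWidthBall ev T n ≤ ‖T‖ := by
  refine samp_le ev T (Nat.zero_le n) Fin.elim0 Fin.elim0 (norm_nonneg _) fun f hf => ?_
  simpa using T.le_of_opNorm_le_of_le le_rfl hf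

lemma samp_le_of_points [CompleteSpace H] (ev : H →ₗ[ℝ] (Ω → ℝ)) (k : Ω → H)
    (hrep : ∀ (f : H) (x : Ω), ev f x = ⟪f, k x⟫) (T : H →L[ℝ] Y) {n N : ℕ} (hN : N ≤ n)
    (y : Fin N → Ω) {c : ℝ} (hc : 0 ≤ c)
    (h : ∀ f : H, (∀ i, ⟪k (y i), f⟫ = 0) → ‖T f‖ ^ 2 ≤ c * ‖f‖ ^ 2) :
    sampWidthBall (fun f => ev f) T n ≤ √c := by
  set U : Submodule ℝ H := Submodule.span ℝ (Set.range fun i => k (y i)) with hU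
  have : FiniteDimensional ℝ U := FiniteDimensional.span_of_finite ℝ (Set.finite_range _)
  let l : H →ₗ[ℝ] (Fin N → ℝ) := LinearMap.pi fun i => (LinearMap.proj (y i)) ∘ₗ ev
  have hl : ∀ f i, l f i = ev f (y i) := fun f i => rfl
  have hkU : ∀ i, k (y i) ∈ U := fun i => Submodule.subset_span ⟨i, rfl⟩
  obtain ⟨φ, hφ⟩ := factor_lemma l (T.toLinearMap ∘ₗ U.starProjection.toLinearMap) (fun f hf => by
    have : f ∈ Uᗮ := by
      rw [Submodule.mem_orthogonal]
      intro u hu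
      induction hu using Submodule.span_induction with
      | mem x hx =>
        obtain ⟨i, rfl⟩ := hx
        have := congrFun hf i
        rw [hl, hrep, real_inner_comm] at this
        exact this
      | zero => simp
      | add a b _ _ h1 h2 => rw [inner_add_left, h1, h2, add_zero]
      | smul r a _ h1 => rw [inner_smul_left, h1, mul_zero]
    have h0 : U.starProjection f = 0 := by
      rw [Submodule.starProjection_apply_eq_zero_iff]; exact this
    simp [h0])
  refine samp_le _ T hN y φ (Real.sqrt_nonneg c) fun f hf => ?_
  have e : ∑ i, ev f (y i) • φ i = T (U.starProjection f) := (hφ f).symm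
  rw [e, ← map_sub]
  apply Real.le_sqrt_of_sq_le
  have ho : f - U.starProjection f ∈ Uᗮ := Submodule.sub_starProjection_mem_orthogonal f
  refine (h _ fun i => ho _ (hkU i)).trans ?_
  have hn : ‖f - U.starProjection f‖ ≤ 1 := by
    rw [← Submodule.starProjection_orthogonal_val]
    exact (Submodule.norm_starProjection_apply_le _ _).trans hf
  have : ‖f - U.starProjection f‖ ^ 2 ≤ 1 := pow_le_one₀ (norm_nonneg _) hn
  nlinarith

lemma meas_kfun {Ω H : Type*} [MeasurableSpace Ω] {ν : Measure Ω} [NormedAddCommGroup H]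
    [InnerProductSpace ℝ H] [CompleteSpace H]
    [TopologicalSpace.SeparableSpace H] (k : Ω → H)
    (h : ∀ f, AEStronglyMeasurable (fun x => ⟪f, k x⟫) ν) : AEStronglyMeasurable k ν := by
  obtain ⟨w, b, hb⟩ := exists_hilbertBasis ℝ H
  have hcount : Countable w := by
    have ho := b.orthonormal
    have hd : ∀ i j : w, i ≠ j → 1 ≤ dist (b i) (b j) := fun i j hij => by
      have h1 : ‖b i - b j‖ ^ 2 = 2 := by
        rw [norm_sub_sq_real, ho.1 i, ho.1 j, ho.2 hij]; norm_num
      rw [dist_eq_norm]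
      nlinarith [norm_nonneg (b i - b j)]
    have hdisj : Pairwise (Function.onFun Disjoint fun i : w => Metric.ball (b i) (1 / 2)) :=
      fun i j hij => Metric.ball_disjoint_ball (by have := hd i j hij; linarith)
    exact hdisj.countable_of_isOpen_disjoint (fun i => Metric.isOpen_ball)
      (fun i => ⟨b i, Metric.mem_ball_self (by norm_num)⟩)
  refine aestronglyMeasurable_of_tendsto_ae (atTop : Filter (Finset w))
    (f := fun s x => ∑ i ∈ s, ⟪b i, k x⟫ • b i) (fun s => ?_) ?_
  · exact Finset.aestronglyMeasurable_fun_sum s fun i _ => (h (b i)).smul_const _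
  · filter_upwards with x
    have := b.hasSum_repr (k x)
    simp_rw [b.repr_apply_apply] at this
    exact this

end widths

section numerics

lemma tailA {r : ℝ} (hr0 : 0 ≤ r) (hr : r < 1) (b : ℝ) :
    ∃ M : ℝ, 0 < M ∧ ∀ J : ℕ, Summable (fun i : ℕ => r ^ i * ((J : ℝ) + i + 1) ^ (-b)) ∧
      ∑' i : ℕ, r ^ i * ((J : ℝ) + i + 1) ^ (-b) ≤ M * ((J : ℝ) + 1) ^ (-b) := by
  obtain ⟨m, hm⟩ := exists_nat_ge |b|
  have hs0 : Summable (fun i : ℕ => (i : ℝ) ^ m * r ^ i) :=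
    summable_pow_mul_geometric_of_norm_lt_one m (by rwa [Real.norm_of_nonneg hr0])
  have hs : Summable (fun i : ℕ => r ^ i * ((i : ℝ) + 1) ^ m) := by
    have h1 : Summable (fun i : ℕ => 2 ^ m * ((i : ℝ) ^ m * r ^ i) + r ^ i) :=
      (hs0.mul_left _).add (summable_geometric_of_lt_one hr0 hr)
    refine Summable.of_nonneg_of_le (fun i => by positivity) (fun i => ?_) h1
    rcases Nat.eq_zero_or_pos i with rfl | hi
    · simp only [Nat.cast_zero, zero_add, one_pow, pow_zero, mul_one]
      have : (0:ℝ) ≤ 2 ^ m * 0 ^ m := by positivity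
      linarith
    · have h2 : ((i : ℝ) + 1) ^ m ≤ (2 * i) ^ m := by
        have : (1:ℝ) ≤ i := by exact_mod_cast hi
        gcongr; linarith
      have h3 : 0 ≤ r ^ i := by positivity
      rw [mul_pow] at h2
      nlinarith [mul_le_mul_of_nonneg_left h2 h3]
  have hle : ∀ (J i : ℕ), r ^ i * ((J : ℝ) + i + 1) ^ (-b) ≤
      (r ^ i * ((i : ℝ) + 1) ^ m) * ((J : ℝ) + 1) ^ (-b) := by
    intro J i
    have hJ : (0:ℝ) < (J : ℝ) + 1 := by positivity
    have hq1 : (1:ℝ) ≤ ((J : ℝ) + i + 1) / (J + 1) := by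
      rw [le_div_iff₀ hJ]; have : (0:ℝ) ≤ i := by positivity
      linarith
    have hq2 : ((J : ℝ) + i + 1) / (J + 1) ≤ i + 1 := by
      rw [div_le_iff₀ hJ]; have : (0:ℝ) ≤ i * J := by positivity
      nlinarith
    have e : ((J : ℝ) + i + 1) = (((J : ℝ) + i + 1) / (J + 1)) * (J + 1) := by
      field_simp
    have h1 : (((J : ℝ) + i + 1) / (J + 1)) ^ (-b) ≤ ((i : ℝ) + 1) ^ m := by
      calc (((J : ℝ) + i + 1) / (J + 1)) ^ (-b) ≤ (((J : ℝ) + i + 1) / (J + 1)) ^ (m : ℝ) :=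
            Real.rpow_le_rpow_of_exponent_le hq1 ((neg_le_abs b).trans hm)
        _ = (((J : ℝ) + i + 1) / (J + 1)) ^ m := Real.rpow_natCast _ _
        _ ≤ _ := by gcongr
    rw [e, Real.mul_rpow (by positivity) hJ.le, mul_assoc]
    gcongr
  refine ⟨∑' i : ℕ, r ^ i * ((i : ℝ) + 1) ^ m, ?_, fun J => ?_⟩
  · refine hs.tsum_pos (fun i => by positivity) 0 (by simp)
  · have h2 := hs.mul_right (((J : ℝ) + 1) ^ (-b))
    have h1 : Summable (fun i : ℕ => r ^ i * ((J : ℝ) + i + 1) ^ (-b)) :=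
      Summable.of_nonneg_of_le (fun i => by positivity) (hle J) h2
    refine ⟨h1, ?_⟩
    rw [← tsum_mul_right]
    exact h1.tsum_le_tsum (hle J) h2

lemma tele {s x : ℝ} (hs : 0 < s) (hx : 1 ≤ x) :
    x ^ (-(s + 1)) ≤ (2 ^ (s + 1) / s) * (x ^ (-s) - (x + 1) ^ (-s)) := by
  have hx0 : 0 < x := by linarith
  have hy0 : 0 < x / (x + 1) := by positivity
  have h1 : (x / (x + 1)) ^ (-s) ≥ 1 + s / (x + 1) := by
    rw [Real.rpow_def_of_pos hy0]
    have h2 := Real.add_one_le_exp (Real.log (x / (x + 1)) * (-s))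
    have h3 := Real.log_le_sub_one_of_pos hy0
    have h4 : x / (x + 1) - 1 = -(1 / (x + 1)) := by field_simp; ring
    rw [h4] at h3
    have h5 : s / (x + 1) = s * (1 / (x + 1)) := by ring
    rw [h5]
    nlinarith
  have e : x ^ (-s) = (x / (x + 1)) ^ (-s) * (x + 1) ^ (-s) := by
    rw [← Real.mul_rpow hy0.le (by positivity)]; congr 1; field_simp
  have h6 : x ^ (-s) - (x + 1) ^ (-s) ≥ s * (x + 1) ^ (-(s + 1)) := by
    have h7 : (x + 1) ^ (-(s + 1)) = (x + 1) ^ (-s) / (x + 1) := by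
      rw [show -(s + 1) = -s - 1 by ring, Real.rpow_sub_one (by positivity)]
    rw [h7, e]
    have h8 : 0 < (x + 1) ^ (-s) := by positivity
    have := mul_le_mul_of_nonneg_right h1 h8.le
    have h9 : s * ((x + 1) ^ (-s) / (x + 1)) = s / (x + 1) * (x + 1) ^ (-s) := by ring
    rw [h9]; linarith
  have h10 : (2:ℝ) ^ (-(s + 1)) * x ^ (-(s + 1)) ≤ (x + 1) ^ (-(s + 1)) := by
    rw [← Real.mul_rpow (by norm_num) hx0.le]
    exact Real.rpow_le_rpow_of_nonpos (by positivity) (by linarith) (by linarith)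
  have h11 : (2:ℝ) ^ (s + 1) * 2 ^ (-(s + 1)) = 1 := by
    rw [← Real.rpow_add (by norm_num)]; simp
  have h12 : (0:ℝ) < 2 ^ (s + 1) := by positivity
  calc x ^ (-(s + 1)) = 2 ^ (s + 1) * (2 ^ (-(s + 1)) * x ^ (-(s + 1))) := by
        rw [← mul_assoc, h11, one_mul]
    _ ≤ 2 ^ (s + 1) * (x + 1) ^ (-(s + 1)) := by gcongr
    _ = (2 ^ (s + 1) / s) * (s * (x + 1) ^ (-(s + 1))) := by field_simp
    _ ≤ _ := by gcongr

lemma tailB {b : ℝ} (hb : 1 < b) :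
    ∃ M : ℝ, 0 < M ∧ ∀ J : ℕ, Summable (fun i : ℕ => ((J : ℝ) + i + 1) ^ (-b)) ∧
      ∑' i : ℕ, ((J : ℝ) + i + 1) ^ (-b) ≤ M * ((J : ℝ) + 1) ^ (-(b - 1)) := by
  have hs : 0 < b - 1 := by linarith
  refine ⟨2 ^ (b - 1 + 1) / (b - 1), by positivity, fun J => ⟨?_, ?_⟩⟩
  · have h := (Real.summable_nat_rpow (p := -b)).2 (by linarith)
    have h2 := (summable_nat_add_iff (J + 1)).2 h
    refine h2.congr fun i => ?_
    push_cast
    congr 1; ring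
  · refine Real.tsum_le_of_sum_range_le (fun i => by positivity) fun n => ?_
    have hterm : ∀ i : ℕ, ((J : ℝ) + i + 1) ^ (-b) ≤ 2 ^ (b - 1 + 1) / (b - 1) *
        (((J : ℝ) + i + 1) ^ (-(b - 1)) - ((J : ℝ) + (i + 1 : ℕ) + 1) ^ (-(b - 1))) := by
      intro i
      have h := tele (x := (J : ℝ) + i + 1) hs (by
        have : (0:ℝ) ≤ (J : ℝ) + i := by positivity
        linarith)
      rw [show -(b - 1 + 1) = -b by ring] at h
      push_cast
      rw [show (J : ℝ) + (i + 1) + 1 = J + i + 1 + 1 by ring]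
      exact h
    refine (Finset.sum_le_sum fun i _ => hterm i).trans ?_
    rw [← Finset.mul_sum,
      Finset.sum_range_sub' (fun i : ℕ => ((J : ℝ) + i + 1) ^ (-(b - 1)))]
    have : 0 ≤ ((J : ℝ) + n + 1) ^ (-(b - 1)) := by positivity
    have h0 : 0 ≤ (2:ℝ) ^ (b - 1 + 1) / (b - 1) := by positivity
    refine mul_le_mul_of_nonneg_left ?_ h0
    simp only [Nat.cast_zero, add_zero]
    linarith

lemma rpow_compare {c1 c2 x y : ℝ} (hc1 : 0 < c1) (hc2 : 0 < c2) (hy : 0 < y) (g : ℝ)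
    (h1 : c1 * y ≤ x) (h2 : x ≤ c2 * y) : y ^ (-g) ≤ (c1 ^ g + c2 ^ g) * x ^ (-g) := by
  have hx : 0 < x := (mul_pos hc1 hy).trans_le h1
  have p1 : 0 < c1 ^ g := by positivity
  have p2 : 0 < c2 ^ g := by positivity
  have px : 0 < x ^ (-g) := by positivity
  have aux : ∀ c : ℝ, 0 < c → y ^ (-g) = c ^ g * (c * y) ^ (-g) := fun c hc => by
    rw [Real.mul_rpow hc.le hy.le, ← mul_assoc, ← Real.rpow_add hc]; simp
  rcases le_total 0 g with hg | hg
  · have : (c2 * y) ^ (-g) ≤ x ^ (-g) := Real.rpow_le_rpow_of_nonpos hx h2 (by linarith)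
    rw [aux c2 hc2]
    nlinarith [mul_le_mul_of_nonneg_left this p2.le, mul_pos p1 px]
  · have : (c1 * y) ^ (-g) ≤ x ^ (-g) := Real.rpow_le_rpow (by positivity) h1 (by linarith)
    rw [aux c1 hc1]
    nlinarith [mul_le_mul_of_nonneg_left this p1.le, mul_pos p2 px]

lemma final_num (s : ℕ → ℝ) {B K α g : ℝ} (hB : ∀ n, s n ≤ B) (hK : 0 ≤ K) (hα : 0 < α)
    (h : ∀ J n : ℕ, 192 * 2 ^ J ≤ n → s n ≤ K * ((2:ℝ) ^ J) ^ (-α) * ((J : ℝ) + 1) ^ (-g)) :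
    ∃ C' : ℝ, 0 < C' ∧ ∀ n : ℕ, 2 ≤ n → s n ≤ C' * (n : ℝ) ^ (-α) * (Real.log n) ^ (-g) := by
  set w : ℕ → ℝ := fun n => (n : ℝ) ^ (-α) * (Real.log n) ^ (-g) with hw
  have hwpos : ∀ n : ℕ, 2 ≤ n → 0 < w n := fun n hn => by
    have h1 : (1:ℝ) < n := by exact_mod_cast hn
    have := Real.log_pos h1
    simp only [hw]; positivity
  have hl2 : 0 < Real.log 2 := Real.log_pos (by norm_num)
  have hl3 : 0 < Real.log 384 := Real.log_pos (by norm_num)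
  set C1 : ℝ := ∑ n ∈ Finset.Ico 2 192, |B| / w n with hC1
  have hC1n : 0 ≤ C1 := Finset.sum_nonneg fun n hn =>
    div_nonneg (abs_nonneg _) (hwpos n (Finset.mem_Ico.1 hn).1).le
  set C2 : ℝ := K * (384:ℝ) ^ α * ((Real.log 2) ^ g + (Real.log 384) ^ g) with hC2
  have hC2n : 0 ≤ C2 := by positivity
  refine ⟨C1 + C2 + 1, by positivity, fun n hn => ?_⟩
  have hwn := hwpos n hn
  rw [mul_assoc]
  change s n ≤ (C1 + C2 + 1) * w n
  rcases lt_or_ge n 192 with hlt | hge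
  · have h1 : |B| / w n ≤ C1 := Finset.single_le_sum (f := fun n => |B| / w n)
      (fun m hm => div_nonneg (abs_nonneg _) (hwpos m (Finset.mem_Ico.1 hm).1).le)
      (Finset.mem_Ico.2 ⟨hn, hlt⟩)
    rw [div_le_iff₀ hwn] at h1
    have := (hB n).trans (le_abs_self B)
    nlinarith [mul_nonneg hC2n hwn.le]
  · set J := Nat.log 2 (n / 192) with hJ
    have hne : n / 192 ≠ 0 := by omega
    have a1 : 2 ^ J ≤ n / 192 := Nat.pow_log_le_self 2 hne
    have a2 : n / 192 < 2 ^ (J + 1) := Nat.lt_pow_succ_log_self (by norm_num) _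
    have b1 : 192 * 2 ^ J ≤ n := by omega
    have b2 : n ≤ 384 * 2 ^ J := by rw [pow_succ] at a2; omega
    have b1r : 192 * (2:ℝ) ^ J ≤ n := by exact_mod_cast b1
    have b2r : (n:ℝ) ≤ 384 * 2 ^ J := by exact_mod_cast b2
    have hn0 : (0:ℝ) < n := by positivity
    have c1 : ((2:ℝ) ^ J) ^ (-α) ≤ (384:ℝ) ^ α * (n:ℝ) ^ (-α) := by
      have : (384 * (2:ℝ) ^ J) ^ (-α) ≤ (n:ℝ) ^ (-α) :=
        Real.rpow_le_rpow_of_nonpos hn0 b2r (by linarith)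
      rw [Real.mul_rpow (by norm_num) (by positivity)] at this
      calc ((2:ℝ) ^ J) ^ (-α) = (384:ℝ) ^ α * ((384:ℝ) ^ (-α) * ((2:ℝ) ^ J) ^ (-α)) := by
            rw [← mul_assoc, ← Real.rpow_add (by norm_num)]; simp
        _ ≤ _ := by gcongr
    have d1 : Real.log 2 * ((J:ℝ) + 1) ≤ Real.log n := by
      have : Real.log ((2:ℝ) ^ (J + 1)) ≤ Real.log n :=
        Real.log_le_log (by positivity) (by
          rw [pow_succ]; have : (0:ℝ) < 2 ^ J := by positivity
          linarith)
      rw [Real.log_pow] at this; push_cast at this; linarith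
    have d2 : Real.log n ≤ Real.log 384 * ((J:ℝ) + 1) := by
      have : Real.log n ≤ Real.log ((384:ℝ) ^ (J + 1)) :=
        Real.log_le_log hn0 (by
          have : (2:ℝ) ^ J ≤ 384 ^ J := by gcongr; norm_num
          rw [pow_succ]; linarith)
      rw [Real.log_pow] at this; push_cast at this; linarith
    have c2 := rpow_compare hl2 hl3 (by positivity) g d1 d2
    have hln : 0 < Real.log n := lt_of_lt_of_le (by positivity) d1
    have h3 : s n ≤ C2 * w n := by
      refine (h J n b1).trans ?_
      calc K * ((2:ℝ) ^ J) ^ (-α) * ((J : ℝ) + 1) ^ (-g)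
          ≤ K * ((384:ℝ) ^ α * (n:ℝ) ^ (-α)) *
            ((Real.log 2 ^ g + Real.log 384 ^ g) * Real.log n ^ (-g)) := by gcongr
        _ = C2 * w n := by simp only [hC2, hw]; ring
    nlinarith [mul_nonneg hC1n hwn.le]

end numerics

section assembly

lemma sq_rpow_neg {x : ℝ} (hx : 0 ≤ x) (t : ℝ) : (x ^ (-t)) ^ 2 = x ^ (-(2 * t)) := by
  rw [← Real.rpow_natCast, ← Real.rpow_mul hx]; congr 1; push_cast; ring

lemma pow_rpow_swap {x : ℝ} (hx : 0 ≤ x) (t : ℝ) (n : ℕ) : (x ^ n) ^ t = (x ^ t) ^ n := by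
  rw [← Real.rpow_natCast, ← Real.rpow_natCast, ← Real.rpow_mul hx, ← Real.rpow_mul hx, mul_comm]

lemma master {Ω H : Type*} [MeasurableSpace Ω]
    (ν : Measure Ω) [NormedAddCommGroup H] [InnerProductSpace ℝ H] [CompleteSpace H]
    [TopologicalSpace.SeparableSpace H]
    (ev : H →ₗ[ℝ] (Ω → ℝ)) (kfun : Ω → H)
    (hrep : ∀ (f : H) (x : Ω), ev f x = ⟪f, kfun x⟫)
    (T : H →L[ℝ] Lp ℝ 2 ν)
    (hTinj : Function.Injective T)
    (hTev : ∀ f : H, (T f : Ω → ℝ) =ᵐ[ν] ev f)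
    (htrace : Integrable (fun x => ⟪kfun x, kfun x⟫) ν)
    (α β C g : ℝ) (hα : 0 < α) (hC : 0 < C)
    (hd : ∀ n : ℕ, 2 ≤ n →
      kolWidth (T '' Metric.closedBall (0 : H) 1) n ≤
        C * (n : ℝ) ^ (-α) * (Real.log n) ^ (-β))
    (hM : ∃ M : ℝ, 0 < M ∧ ∀ J : ℕ,
      Summable (fun i : ℕ => (2 * (2:ℝ) ^ (-(2 * α))) ^ i * ((J : ℝ) + i + 1) ^ (-(2 * β))) ∧
      ∑' i : ℕ, (2 * (2:ℝ) ^ (-(2 * α))) ^ i * ((J : ℝ) + i + 1) ^ (-(2 * β)) ≤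
        M * ((J : ℝ) + 1) ^ (-(2 * g))) :
    ∃ C' : ℝ, 0 < C' ∧ ∀ n : ℕ, 2 ≤ n →
        sampWidthBall (fun f => ev f) T n ≤
          C' * (n : ℝ) ^ (-α) * (Real.log n) ^ (-g) := by
  obtain ⟨M, hM0, hM⟩ := hM
  rcases isEmpty_or_nonempty Ω with hΩ | hΩ
  · have hT0 : T = 0 := by
      ext1 f
      refine Lp.ext ?_
      exact Filter.Eventually.of_forall fun x => (hΩ.false x).elim
    refine ⟨1, one_pos, fun n hn => ?_⟩
    have h1 : (1:ℝ) < n := by exact_mod_cast hn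
    have := Real.log_pos h1
    refine (samp_le_norm _ T n).trans ?_
    rw [hT0, norm_zero]; positivity
  have hk : AEStronglyMeasurable kfun ν := by
    refine meas_kfun kfun fun f => ?_
    refine (Lp.aestronglyMeasurable (T f)).congr ((hTev f).trans ?_)
    exact Filter.Eventually.of_forall fun x => hrep f x
  have hk2 : Integrable (fun x => ‖kfun x‖ ^ 2) ν := by
    simpa only [real_inner_self_eq_norm_sq] using htrace
  have hS : ∀ f g, ⟪(T.adjoint ∘L T) f, g⟫ = ⟪T f, T g⟫ := fun f g => by
    rw [ContinuousLinearMap.comp_apply, ContinuousLinearMap.adjoint_inner_left]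
  have hT : ∀ g, ∫ x, ⟪g, kfun x⟫ ^ 2 ∂ν = ‖T g‖ ^ 2 := fun g => by
    rw [← real_inner_self_eq_norm_sq, L2.inner_def]
    refine integral_congr_ae ?_
    filter_upwards [hTev g] with x hx
    rw [hx, hrep, real_inner_self_eq_norm_sq, Real.norm_eq_abs, sq_abs]
  set q : ℝ := (2:ℝ) ^ (-(2 * α)) with hq
  have hq0 : 0 < q := by positivity
  have hl2 : 0 < Real.log 2 := Real.log_pos (by norm_num)
  set D : ℕ → ℝ := fun j => C * ((2 ^ (j + 1) : ℕ) : ℝ) ^ (-α) *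
    (Real.log ((2 ^ (j + 1) : ℕ) : ℝ)) ^ (-β) with hD
  have hlog : ∀ j : ℕ, Real.log ((2 ^ (j + 1) : ℕ) : ℝ) = ((j : ℝ) + 1) * Real.log 2 := fun j => by
    push_cast; rw [Real.log_pow]; push_cast; ring
  have hDpos : ∀ j, 0 < D j := fun j => by
    simp only [hD, hlog]; positivity
  have hL : ∀ j : ℕ, ∃ L : Submodule ℝ H, FiniteDimensional ℝ L ∧
      Module.finrank ℝ L ≤ 2 ^ (j + 1) ∧ ∀ f ∈ Lᗮ, ‖T f‖ ≤ (2 * D j) * ‖f‖ := fun j => by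
    refine kol_subspace T _ _ ((hd (2 ^ (j + 1)) ?_).trans_lt ?_)
    · rw [pow_succ]; have := Nat.one_le_two_pow (n := j); omega
    · have := hDpos j
      change D j < 2 * D j
      linarith
  choose L hLf hLn hLb using hL
  set K0 : ℝ := 4 * C ^ 2 * q * (Real.log 2) ^ (-(2 * β)) with hK0
  have hK0p : 0 < K0 := by positivity
  have ha : ∀ j, (2 * D j) ^ 2 = K0 * (q ^ j * ((j : ℝ) + 1) ^ (-(2 * β))) := fun j => by
    simp only [hD, hlog]
    rw [mul_pow, mul_pow, mul_pow, sq_rpow_neg (by positivity), sq_rpow_neg (by positivity),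
      Real.mul_rpow (by positivity) hl2.le]
    push_cast
    rw [pow_rpow_swap (by norm_num), ← hq, hK0]
    ring
  have hterm : ∀ J i : ℕ, (2:ℝ) ^ i * (2 * D (J + i)) ^ 2 =
      (K0 * q ^ J) * ((2 * q) ^ i * ((J : ℝ) + i + 1) ^ (-(2 * β))) := fun J i => by
    rw [ha]; push_cast; rw [mul_pow, pow_add]; ring
  have hsum : Summable fun j : ℕ => (2:ℝ) ^ j * (2 * D j) ^ 2 := by
    have := ((hM 0).1.mul_left (K0 * q ^ 0))
    refine this.congr fun i => ?_
    rw [← hterm 0 i, zero_add]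
  have hLb2 : ∀ j, ∀ f ∈ (L j)ᗮ, ‖T f‖ ^ 2 ≤ (2 * D j) ^ 2 * ‖f‖ ^ 2 := fun j f hf => by
    rw [← mul_pow]
    exact pow_le_pow_left₀ (norm_nonneg _) (hLb j f hf) 2
  refine final_num (fun n => sampWidthBall (fun f => ev f) T n) (B := ‖T‖) (K := √(6 * K0 * M))
    (fun n => samp_le_norm _ T n) (Real.sqrt_nonneg _) hα fun J n hn => ?_
  obtain ⟨y, hy⟩ := points_exist hk hk2 hS hT hTinj L hLn (a := fun j => (2 * D j) ^ 2)
    (fun j => by have := hDpos j; positivity) hLb2 hsum J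
  have hA : (∑' i : ℕ, (2:ℝ) ^ i * (2 * D (J + i)) ^ 2) ≤
      K0 * M * q ^ J * ((J : ℝ) + 1) ^ (-(2 * g)) := by
    simp only [hterm]
    rw [tsum_mul_left]
    calc _ ≤ (K0 * q ^ J) * (M * ((J : ℝ) + 1) ^ (-(2 * g))) :=
          mul_le_mul_of_nonneg_left (hM J).2 (by positivity)
      _ = _ := by ring
  have hA0 : 0 ≤ 6 * (∑' i : ℕ, (2:ℝ) ^ i * (2 * D (J + i)) ^ 2) :=
    mul_nonneg (by norm_num) (tsum_nonneg fun i => by positivity)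
  refine (samp_le_of_points ev kfun hrep T hn y hA0 hy).trans ?_
  apply Real.sqrt_le_iff.2
  refine ⟨by positivity, ?_⟩
  rw [mul_pow, mul_pow, Real.sq_sqrt (by positivity), sq_rpow_neg (by positivity),
    sq_rpow_neg (by positivity), pow_rpow_swap (by norm_num), ← hq]
  linarith

end assembly

/-- for a separable RKHS `H` compactly embedded into `L₂(Ω;ν)` with
finite trace, if `d_n(B_H,L₂) ≤ C n^{-α} (log n)^{-β}` with `α ≥ 1/2`, then
`ϱ_n(B_H,L₂) ≤ C' n^{-α} (log n)^{-β}` when `α > 1/2`, and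
`ϱ_n(B_H,L₂) ≤ C' n^{-α} (log n)^{-β+1/2}` when `α = 1/2` and `β > 1/2`. -/
theorem sampWidth_decay_of_kolWidth_decay_rkhs {Ω H : Type*} [MeasurableSpace Ω]
    (ν : Measure Ω) [NormedAddCommGroup H] [InnerProductSpace ℝ H] [CompleteSpace H]
    [TopologicalSpace.SeparableSpace H]
    (ev : H →ₗ[ℝ] (Ω → ℝ)) (kfun : Ω → H)
    (hrep : ∀ (f : H) (x : Ω), ev f x = ⟪f, kfun x⟫)
    (T : H →L[ℝ] Lp ℝ 2 ν) (hTcompact : IsCompactOperator T)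
    (hTinj : Function.Injective T)
    (hTev : ∀ f : H, (T f : Ω → ℝ) =ᵐ[ν] ev f)
    (htrace : Integrable (fun x => ⟪kfun x, kfun x⟫) ν)
    (α β C : ℝ) (hα : (1:ℝ)/2 ≤ α) (hC : 0 < C)
    (hd : ∀ n : ℕ, 2 ≤ n →
      kolWidth (T '' Metric.closedBall (0 : H) 1) n ≤
        C * (n : ℝ) ^ (-α) * (Real.log n) ^ (-β)) :
    ((1:ℝ)/2 < α →
      ∃ C' : ℝ, 0 < C' ∧ ∀ n : ℕ, 2 ≤ n →
        sampWidthBall (fun f => ev f) T n ≤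
          C' * (n : ℝ) ^ (-α) * (Real.log n) ^ (-β)) ∧
    (α = (1:ℝ)/2 → (1:ℝ)/2 < β →
      ∃ C' : ℝ, 0 < C' ∧ ∀ n : ℕ, 2 ≤ n →
        sampWidthBall (fun f => ev f) T n ≤
          C' * (n : ℝ) ^ (-α) * (Real.log n) ^ (-β + 1/2)) := by
  have hα0 : 0 < α := by linarith
  constructor
  · intro hα1
    refine master ν ev kfun hrep T hTinj hTev htrace α β C β hα0 hC hd ?_
    refine tailA (by positivity) ?_ (2 * β)
    rw [← Real.rpow_one_add' (by norm_num) (by linarith)]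
    exact Real.rpow_lt_one_of_one_lt_of_neg (by norm_num) (by linarith)
  · intro hα1 hβ
    obtain ⟨M, hM0, hM⟩ := tailB (b := 2 * β) (by linarith)
    have hm := master ν ev kfun hrep T hTinj hTev htrace α β C (β - 1 / 2) hα0 hC hd
      ⟨M, hM0, fun J => by
        have e : (2 * (2:ℝ) ^ (-(2 * α))) = 1 := by
          rw [hα1, show -(2 * ((1:ℝ) / 2)) = -1 by norm_num, Real.rpow_neg_one]; norm_num
        rw [e]
        simp only [one_pow, one_mul]
        rw [show 2 * (β - 1 / 2) = 2 * β - 1 by ring]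
        exact hM J⟩
    rwa [show -(β - 1 / 2) = -β + 1 / 2 by ring] at hm
end
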